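/- arXiv:2402.00957 — 8 statements merged into one kernel-verified Lean document; each statement's English description precedes it below -/
import Mathlib

section
/- Let 𝒫 = conv{P_1,…,P_m} be a finitely generated credal set of probability measures on Z and let P ∈ 𝒫. Let H be a finite nonempty hypothesis class with measurable error sets, assume realizability with respect to P (there exists h* ∈ H with L_P(h*) = 0), and let ĥ be an empirical risk minimizer on samples of size n ≥ 1. Then for every ε > 0, writing B_j(ε) = {h ∈ H : L_{P_j}(h) > ε} for j = 1,…,m, one has P^{⊗n}({s ∈ Z^n : L_P(ĥ(s)) > ε}) ≤ |⋃_{j=1}^m B_j(ε)| · exp(−ε n). -/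
open MeasureTheory Finset
open scoped ENNReal NNReal Classical

variable {X Y : Type*}

/-- The error set of hypothesis `h : X → Y`. -/
def errSet (h : X → Y) : Set (X × Y) := {p | p.2 ≠ h p.1}

variable [MeasurableSpace X] [MeasurableSpace Y]

/-- Expected risk of `h` under `P` with the zero-one loss: `L_P(h) = P(A_h)`. -/
noncomputable def risk (P : Measure (X × Y)) (h : X → Y) : ℝ := (P (errSet h)).toReal

/-- Empirical risk of `h` on the sample `s` of size `n`. -/
noncomputable def empRisk {n : ℕ} (s : Fin n → X × Y) (h : X → Y) : ℝ :=
  ((Finset.univ.filter fun i => (s i).2 ≠ h (s i).1).card : ℝ) / n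

/-- `A` is an empirical risk minimizer over the hypothesis class `H`. -/
def IsERM {n : ℕ} (H : Finset (X → Y)) (A : (Fin n → X × Y) → (X → Y)) : Prop :=
  ∀ s, A s ∈ H ∧ ∀ h ∈ H, empRisk s (A s) ≤ empRisk s h

/-- Measurability of a hypothesis-valued map (sufficient notion since `H` is finite). -/
def MeasurableERM {n : ℕ} (A : (Fin n → X × Y) → (X → Y)) : Prop :=
  ∀ h : X → Y, MeasurableSet {s | A s = h}

/-- Membership in the finitely generated credal set `conv{P_1, …, P_m}`. -/
def memCredal {Z : Type*} [MeasurableSpace Z] {m : ℕ} (Pm : Fin m → Measure Z)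
    (P : Measure Z) : Prop :=
  ∃ w : Fin m → ℝ≥0, (∑ j, w j = 1) ∧ P = ∑ j, (w j : ℝ≥0∞) • Pm j

/-- Total variation distance between measures. -/
noncomputable def dTV {Z : Type*} [MeasurableSpace Z] (P Q : Measure Z) : ℝ :=
  ⨆ A : {A : Set Z // MeasurableSet A}, |(P A.1).toReal - (Q A.1).toReal|

/-- Rademacher complexity of the zero-one loss class of `H` at sample size `n` under `P`. -/
noncomputable def rademacher (n : ℕ) (P : Measure (X × Y)) (H : Finset (X → Y)) : ℝ :=
  ∫ p : (Fin n → X × Y) × (Fin n → Bool),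
    (⨆ h : H, (∑ i, (if p.2 i then (1 : ℝ) else -1) *
      (if (p.1 i).2 ≠ (h : X → Y) (p.1 i).1 then 1 else 0)) / n)
    ∂((Measure.pi fun _ => P).prod (Measure.pi fun _ => (PMF.uniformOfFintype Bool).toMeasure))

/-- A hypothesis of risk larger than `ε` is consistent with an i.i.d. sample of size `n` with
probability at most `exp (-ε n)`. -/
lemma pi_consistent_le {n : ℕ} (P : Measure (X × Y)) [IsProbabilityMeasure P] {h : X → Y}
    (hh : MeasurableSet (errSet h)) {ε : ℝ} (hε : ε < risk P h) :
    (Measure.pi fun _ : Fin n => P) {s | ∀ i, s i ∉ errSet h}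
      ≤ ENNReal.ofReal (Real.exp (-ε * n)) := by
  have hset : {s : Fin n → X × Y | ∀ i, s i ∉ errSet h}
      = Set.univ.pi fun _ => (errSet h)ᶜ := by
    ext s; simp
  have hcompl : P (errSet h)ᶜ ≤ ENNReal.ofReal (Real.exp (-ε)) := by
    rw [← ENNReal.ofReal_toReal (measure_ne_top P (errSet h)ᶜ)]
    apply ENNReal.ofReal_le_ofReal
    have h1 : (P (errSet h)ᶜ).toReal = 1 - risk P h := probReal_compl_eq_one_sub hh
    linarith [Real.add_one_le_exp (-ε)]
  rw [hset, Measure.pi_pi, Finset.prod_const, Finset.card_univ, Fintype.card_fin, mul_comm,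
    Real.exp_nat_mul, ENNReal.ofReal_pow (Real.exp_pos _).le]
  gcongr

/-- A sample almost surely contains no error of a hypothesis of zero risk. -/
lemma ae_pi_consistent {n : ℕ} (P : Measure (X × Y)) [IsProbabilityMeasure P] {h : X → Y}
    (hh : risk P h = 0) :
    ∀ᵐ s ∂(Measure.pi fun _ : Fin n => P), ∀ i, s i ∉ errSet h := by
  have h0 : P (errSet h) = 0 :=
    ((ENNReal.toReal_eq_zero_iff _).1 hh).resolve_right (measure_ne_top _ _)
  rw [ae_all_iff]
  intro i
  exact (Measure.tendsto_eval_ae_ae (μ := fun _ : Fin n => P) (i := i)).eventually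
    (measure_eq_zero_iff_ae_notMem.1 h0)

/-- The empirical risk vanishes exactly on the samples without errors. -/
lemma empRisk_eq_zero_iff {n : ℕ} (hn : n ≠ 0) (s : Fin n → X × Y) (h : X → Y) :
    empRisk s h = 0 ↔ ∀ i, s i ∉ errSet h := by
  simp [empRisk, errSet, hn, Finset.filter_eq_empty_iff]

/-- If a mixture has risk larger than `ε`, so does one of its components. -/
lemma exists_risk_gt_of_memCredal {m : ℕ} {Pm : Fin m → Measure (X × Y)}
    [∀ j, IsProbabilityMeasure (Pm j)] {P : Measure (X × Y)} (hP : memCredal Pm P)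
    {h : X → Y} {ε : ℝ} (hε : ε < risk P h) : ∃ j, ε < risk (Pm j) h := by
  obtain ⟨w, hw, rfl⟩ := hP
  by_contra! hle
  have hrisk : risk (∑ j, (w j : ℝ≥0∞) • Pm j) h = ∑ j, (w j : ℝ) * risk (Pm j) h := by
    simp only [risk, Measure.finsetSum_apply, Measure.smul_apply, smul_eq_mul]
    rw [ENNReal.toReal_sum fun j _ => ENNReal.mul_ne_top ENNReal.coe_ne_top (measure_ne_top _ _)]
    simp
  have hw' : ∑ j, (w j : ℝ) = 1 := mod_cast hw
  have : ∑ j, (w j : ℝ) * risk (Pm j) h ≤ ∑ j, (w j : ℝ) * ε :=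
    Finset.sum_le_sum fun j _ => mul_le_mul_of_nonneg_left (hle j) (w j).2
  rw [← Finset.sum_mul, hw', one_mul] at this
  linarith

/-- Credal realizable bound (Theorem 1 of the paper). -/
theorem credal_realizable_bound {m n : ℕ} (hm : 0 < m) (hn : 1 ≤ n)
    (Pm : Fin m → Measure (X × Y)) (hPm : ∀ j, IsProbabilityMeasure (Pm j))
    (P : Measure (X × Y)) [IsProbabilityMeasure P] (hP : memCredal Pm P)
    (H : Finset (X → Y)) (hH : H.Nonempty)
    (hmeas : ∀ h ∈ H, MeasurableSet (errSet h))
    (hreal : ∃ hstar ∈ H, risk P hstar = 0)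
    (erm : (Fin n → X × Y) → (X → Y)) (hermM : MeasurableERM erm) (herm : IsERM H erm)
    (ε : ℝ) (hε : 0 < ε) :
    (Measure.pi fun _ : Fin n => P) {s | risk P (erm s) > ε}
      ≤ ((Finset.univ.biUnion fun j : Fin m =>
            H.filter fun h => risk (Pm j) h > ε).card : ℝ≥0∞)
        * ENNReal.ofReal (Real.exp (-ε * n)) := by
  obtain ⟨hstar, hstarH, hstar0⟩ := hreal
  have hn0 : n ≠ 0 := by omega
  set U := Finset.univ.biUnion fun j : Fin m => H.filter fun h => risk (Pm j) h > ε
  set B := H.filter fun h => ε < risk P h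
  have hBU : B ⊆ U := by
    intro h hh
    obtain ⟨hhH, hhε⟩ := Finset.mem_filter.1 hh
    obtain ⟨j, hj⟩ := exists_risk_gt_of_memCredal hP hhε
    exact Finset.mem_biUnion.2 ⟨j, Finset.mem_univ j, Finset.mem_filter.2 ⟨hhH, hj⟩⟩
  have hsub : {s | risk P (erm s) > ε} ≤ᵐ[Measure.pi fun _ : Fin n => P]
      ⋃ h ∈ B, {s | ∀ i, s i ∉ errSet h} := by
    filter_upwards [ae_pi_consistent P hstar0] with s hs hbad
    obtain ⟨hmem, hmin⟩ := herm s
    have hzero : empRisk s (erm s) = 0 := by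
      refine le_antisymm ?_ (by unfold empRisk; positivity)
      exact (hmin hstar hstarH).trans_eq ((empRisk_eq_zero_iff hn0 s hstar).2 hs)
    exact Set.mem_biUnion (Finset.mem_coe.2 (Finset.mem_filter.2 ⟨hmem, hbad⟩))
      ((empRisk_eq_zero_iff hn0 s _).1 hzero)
  calc (Measure.pi fun _ : Fin n => P) {s | risk P (erm s) > ε}
      ≤ (Measure.pi fun _ : Fin n => P) (⋃ h ∈ B, {s | ∀ i, s i ∉ errSet h}) :=
        measure_mono_ae hsub
    _ ≤ ∑ h ∈ B, (Measure.pi fun _ : Fin n => P) {s | ∀ i, s i ∉ errSet h} :=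
        measure_biUnion_finset_le _ _
    _ ≤ ∑ _h ∈ B, ENNReal.ofReal (Real.exp (-ε * n)) :=
        Finset.sum_le_sum fun h hh =>
          pi_consistent_le P (hmeas h (Finset.mem_filter.1 hh).1) (Finset.mem_filter.1 hh).2
    _ = (B.card : ℝ≥0∞) * ENNReal.ofReal (Real.exp (-ε * n)) := by
        rw [Finset.sum_const, nsmul_eq_mul]
    _ ≤ (U.card : ℝ≥0∞) * ENNReal.ofReal (Real.exp (-ε * n)) := by
        gcongr
end

section
/- Let P be a probability measure on Z, let H be a finite nonempty hypothesis class with measurable error sets, assume realizability (there exists h* ∈ H with L_P(h*) = 0), and let ĥ be an empirical risk minimizer on samples of size n ≥ 1. Then for every δ ∈ (0,1), P^{⊗n}({s ∈ Z^n : L_P(ĥ(s)) ≤ (log|H| + log(1/δ))/n}) ≥ 1 − δ. -/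
open MeasureTheory Finset
open scoped ENNReal NNReal Classical

variable {X Y : Type*}

variable [MeasurableSpace X] [MeasurableSpace Y]

/-- A hypothesis is correct on every point of a sample iff its empirical risk is nonpositive. -/
lemma empRisk_nonpos_iff {X Y : Type*} {n : ℕ} (hn : 1 ≤ n) (s : Fin n → X × Y) (h : X → Y) :
    empRisk s h ≤ 0 ↔ ∀ i, s i ∉ errSet h := by
  have hn' : (0 : ℝ) < n := by exact_mod_cast hn
  rw [empRisk, div_le_iff₀ hn', zero_mul, ← Nat.cast_zero, Nat.cast_le, Nat.le_zero,
    Finset.card_eq_zero, Finset.filter_eq_empty_iff]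
  simp [errSet]

/-- The probability that an i.i.d. sample avoids a set of measure at least `ε` is at most
`exp (-n ε)`. -/
lemma measure_pi_avoid_le {Z : Type*} [MeasurableSpace Z] (P : Measure Z)
    [IsProbabilityMeasure P] (n : ℕ) {A : Set Z} (hA : MeasurableSet A) {ε : ℝ}
    (hε : ε ≤ (P A).toReal) :
    (Measure.pi fun _ : Fin n => P) {s | ∀ i, s i ∉ A} ≤ ENNReal.ofReal (Real.exp (-(n * ε))) := by
  have hset : {s : Fin n → Z | ∀ i, s i ∉ A} = Set.univ.pi fun _ => Aᶜ := by
    ext s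
    simp
  have hcompl : P Aᶜ ≤ ENNReal.ofReal (Real.exp (-ε)) := by
    rw [prob_compl_eq_one_sub hA, ← ENNReal.ofReal_toReal (measure_ne_top P A),
      ← ENNReal.ofReal_one, ← ENNReal.ofReal_sub _ ENNReal.toReal_nonneg]
    refine ENNReal.ofReal_le_ofReal ?_
    linarith [Real.add_one_le_exp (-ε)]
  rw [hset, Measure.pi_pi, Finset.prod_const, Finset.card_univ, Fintype.card_fin, ← mul_neg,
    Real.exp_nat_mul, ENNReal.ofReal_pow (Real.exp_pos _).le]
  gcongr

/-- An i.i.d. sample almost surely avoids a null set. -/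
lemma measure_pi_exists_mem_eq_zero {Z : Type*} [MeasurableSpace Z] (P : Measure Z)
    [IsProbabilityMeasure P] (n : ℕ) {A : Set Z} (hA : P A = 0) :
    (Measure.pi fun _ : Fin n => P) {s | ∃ i, s i ∈ A} = 0 := by
  rw [Set.ofPred_exists, measure_iUnion_null_iff]
  exact fun i => Measure.pi_eval_preimage_null _ hA

/-- Classical realizable PAC bound for a finite hypothesis class. -/
theorem realizable_pac_bound {n : ℕ} (hn : 1 ≤ n)
    (P : Measure (X × Y)) [IsProbabilityMeasure P]
    (H : Finset (X → Y)) (hH : H.Nonempty)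
    (hmeas : ∀ h ∈ H, MeasurableSet (errSet h))
    (hreal : ∃ hstar ∈ H, risk P hstar = 0)
    (erm : (Fin n → X × Y) → (X → Y)) (hermM : MeasurableERM erm) (herm : IsERM H erm)
    (δ : ℝ) (hδ : δ ∈ Set.Ioo (0 : ℝ) 1) :
    (Measure.pi fun _ : Fin n => P)
        {s | risk P (erm s) ≤ (Real.log H.card + Real.log (1 / δ)) / n}
      ≥ ENNReal.ofReal (1 - δ) := by
  obtain ⟨hstar, hstarH, hstar0⟩ := hreal
  obtain ⟨hδ0, -⟩ := hδ
  have hn0 : (n : ℝ) ≠ 0 := by exact_mod_cast (by lia : n ≠ 0)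
  have hcard : (0 : ℝ) < H.card := by exact_mod_cast hH.card_pos
  set ε : ℝ := (Real.log H.card + Real.log (1 / δ)) / n with hε
  set μ := Measure.pi fun _ : Fin n => P
  have hexp : Real.exp (-(n * ε)) = δ / H.card := by
    rw [hε, mul_div_cancel₀ _ hn0, one_div, Real.log_inv, neg_add, neg_neg, Real.exp_add,
      Real.exp_neg, Real.exp_log hcard, Real.exp_log hδ0]
    ring
  have hnull : P (errSet hstar) = 0 :=
    ((ENNReal.toReal_eq_zero_iff _).1 hstar0).resolve_right (measure_ne_top P _)
  have hsub : {s | risk P (erm s) ≤ ε}ᶜ ⊆ {s | ∃ i, s i ∈ errSet hstar} ∪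
      ⋃ h ∈ H.filter fun h => ε < risk P h, {s : Fin n → X × Y | ∀ i, s i ∉ errSet h} := by
    intro s hs
    by_cases hbad : ∃ i, s i ∈ errSet hstar
    · exact Or.inl hbad
    · refine Or.inr (Set.mem_biUnion (x := erm s) ?_ ?_)
      · exact Finset.mem_filter.2 ⟨(herm s).1, not_le.1 hs⟩
      · exact (empRisk_nonpos_iff hn s _).1 (((herm s).2 hstar hstarH).trans
          ((empRisk_nonpos_iff hn s hstar).2 (not_exists.1 hbad)))
  have hcompl : μ {s | risk P (erm s) ≤ ε}ᶜ ≤ ENNReal.ofReal δ := calc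
    μ {s | risk P (erm s) ≤ ε}ᶜ
      ≤ 0 + ∑ h ∈ H.filter fun h => ε < risk P h, μ {s | ∀ i, s i ∉ errSet h} :=
        (measure_mono hsub).trans <| (measure_union_le _ _).trans <|
          add_le_add (measure_pi_exists_mem_eq_zero P n hnull).le
            (measure_biUnion_finset_le _ _)
    _ ≤ ∑ h ∈ H.filter fun h => ε < risk P h, ENNReal.ofReal (δ / H.card) := by
        rw [zero_add, ← hexp]
        refine Finset.sum_le_sum fun h hh => ?_
        obtain ⟨hhH, hlt⟩ := Finset.mem_filter.1 hh
        exact measure_pi_avoid_le P n (hmeas h hhH) hlt.le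
    _ ≤ ∑ h ∈ H, ENNReal.ofReal (δ / H.card) :=
        Finset.sum_le_sum_of_subset (Finset.filter_subset _ _)
    _ = ENNReal.ofReal δ := by
        rw [Finset.sum_const, ← ENNReal.ofReal_nsmul, nsmul_eq_mul,
          mul_div_cancel₀ _ hcard.ne']
  rw [ge_iff_le, ENNReal.ofReal_sub _ hδ0.le, ENNReal.ofReal_one, tsub_le_iff_right]
  calc (1 : ℝ≥0∞) = μ Set.univ := measure_univ.symm
    _ ≤ μ {s | risk P (erm s) ≤ ε} + μ {s | risk P (erm s) ≤ ε}ᶜ := by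
        rw [← Set.union_compl_self {s | risk P (erm s) ≤ ε}]
        exact measure_union_le _ _
    _ ≤ μ {s | risk P (erm s) ≤ ε} + ENNReal.ofReal δ := by gcongr
end

section
/- Let P_1, P_2 be probability measures on Z, let 1 ≤ k < n, and consider a sample s ∈ Z^n whose first k coordinates are i.i.d. from P_1 and whose last n−k coordinates are i.i.d. from P_2, all independent (law P_1^{⊗k} ⊗ P_2^{⊗(n−k)}). Let H be a finite nonempty hypothesis class with measurable error sets, assume there exist h_1*, h_2* ∈ H with L_{P_1}(h_1*) = 0 and L_{P_2}(h_2*) = 0, and let ĥ_1 be an empirical risk minimizer computed on the first k coordinates and ĥ_2 an empirical risk minimizer computed on the last n−k coordinates. Then for every δ ∈ (0,1), with probability at least 1 − 2δ under P_1^{⊗k} ⊗ P_2^{⊗(n−k)}, one has L_{P_1}(ĥ_1) + L_{P_2}(ĥ_2) ≤ (log|H| + log(1/δ)) · n/(k(n−k)). -/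
open MeasureTheory Finset
open scoped ENNReal NNReal Classical

variable {X Y : Type*}

variable [MeasurableSpace X] [MeasurableSpace Y]

/-- If some hypothesis of the class makes no error on the sample, neither does an empirical risk
minimizer. -/
lemma IsERM.notMem_errSet {α β : Type*} {m : ℕ} {H : Finset (α → β)}
    {A : (Fin m → α × β) → (α → β)} (hA : IsERM H A) {h₀ : α → β} (hh₀ : h₀ ∈ H) {s : Fin m → α × β}
    (hs : ∀ i, s i ∉ errSet h₀) (i : Fin m) : s i ∉ errSet (A s) := by
  have hm : (0 : ℝ) < m := by exact_mod_cast i.pos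
  have hle := (hA s).2 h₀ hh₀
  have h_zero : empRisk s h₀ = 0 := by
    simp only [errSet, Set.mem_ofPred_eq, ne_eq, not_not] at hs
    simp [empRisk, hs]
  rw [h_zero, empRisk, div_le_iff₀ hm, zero_mul] at hle
  have hcard : (univ.filter fun i => (s i).2 ≠ A s (s i).1).card = 0 := by
    exact_mod_cast le_antisymm hle (Nat.cast_nonneg _)
  exact Finset.filter_eq_empty_iff.1 (Finset.card_eq_zero.1 hcard) (mem_univ i)

/-- A hypothesis of risk larger than `c / m` is consistent with an i.i.d. sample of size `m` with
probability at most `exp (-c)`. -/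
lemma pi_forall_notMem_errSet_le {m : ℕ} (hm : 1 ≤ m) (P : Measure (X × Y))
    [IsProbabilityMeasure P] {h : X → Y} (hh : MeasurableSet (errSet h)) {c : ℝ}
    (hc : c / m < risk P h) :
    (Measure.pi fun _ : Fin m => P) {s | ∀ i, s i ∉ errSet h} ≤ ENNReal.ofReal (Real.exp (-c)) := by
  have hset : {s : Fin m → X × Y | ∀ i, s i ∉ errSet h} = Set.univ.pi fun _ => (errSet h)ᶜ := by
    ext s
    simp
  have hcompl : P (errSet h)ᶜ = ENNReal.ofReal (1 - risk P h) := by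
    rw [← ofReal_measureReal, probReal_compl_eq_one_sub hh]
    rfl
  have hnonneg : 0 ≤ 1 - risk P h := sub_nonneg.2 (measureReal_le_one (μ := P) (s := errSet h))
  have hm' : (0 : ℝ) < m := by exact_mod_cast hm
  rw [hset, Measure.pi_pi, Finset.prod_const, card_univ, Fintype.card_fin, hcompl,
    ← ENNReal.ofReal_pow hnonneg]
  refine ENNReal.ofReal_le_ofReal ?_
  calc (1 - risk P h) ^ m ≤ Real.exp (-risk P h) ^ m :=
        pow_le_pow_left₀ hnonneg (Real.one_sub_le_exp_neg _) m
    _ = Real.exp (m * -risk P h) := (Real.exp_nat_mul _ m).symm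
    _ ≤ Real.exp (-c) := by
        rw [div_lt_iff₀ hm'] at hc
        gcongr
        linarith

/-- Realizable bound for a finite class: an empirical risk minimizer has risk larger than
`(log |H| + log (1 / δ)) / m` with probability at most `δ`. -/
lemma IsERM.pi_lt_risk_le {m : ℕ} (hm : 1 ≤ m) (P : Measure (X × Y)) [IsProbabilityMeasure P]
    {H : Finset (X → Y)} (hmeas : ∀ h ∈ H, MeasurableSet (errSet h))
    (hreal : ∃ h₀ ∈ H, risk P h₀ = 0) {A : (Fin m → X × Y) → (X → Y)} (hA : IsERM H A)
    {δ : ℝ} (hδ : 0 < δ) :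
    (Measure.pi fun _ : Fin m => P)
      {s | (Real.log H.card + Real.log (1 / δ)) / m < risk P (A s)} ≤ ENNReal.ofReal δ := by
  obtain ⟨h₀, hh₀, hrisk⟩ := hreal
  set c := Real.log H.card + Real.log (1 / δ) with hc
  have hcard : (0 : ℝ) < H.card := by exact_mod_cast card_pos.2 ⟨h₀, hh₀⟩
  have hexp : Real.exp (-c) = δ / H.card := by
    rw [hc, one_div, Real.log_inv, neg_add, neg_neg, Real.exp_add, Real.exp_neg,
      Real.exp_log hcard, Real.exp_log hδ, inv_mul_eq_div]
  have hnull : P (errSet h₀) = 0 :=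
    ((ENNReal.toReal_eq_zero_iff _).1 hrisk).resolve_right (measure_ne_top _ _)
  have hae : ∀ᵐ s ∂(Measure.pi fun _ : Fin m => P), ∀ i, s i ∉ errSet h₀ :=
    ae_all_iff.2 fun i => (measurePreserving_eval (fun _ : Fin m => P) i).quasiMeasurePreserving.ae
      (measure_eq_zero_iff_ae_notMem.1 hnull)
  calc (Measure.pi fun _ : Fin m => P) {s | c / m < risk P (A s)}
      ≤ (Measure.pi fun _ : Fin m => P)
          (⋃ h ∈ H.filter fun h => c / m < risk P h, {s | ∀ i, s i ∉ errSet h}) := by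
        refine measure_mono_ae ?_
        filter_upwards [hae] with s hs hbad
        exact Set.mem_biUnion (x := A s) (by simpa using ⟨(hA s).1, hbad⟩)
          (hA.notMem_errSet hh₀ hs)
    _ ≤ ∑ h ∈ H.filter fun h => c / m < risk P h,
          (Measure.pi fun _ : Fin m => P) {s | ∀ i, s i ∉ errSet h} :=
        measure_biUnion_finset_le _ _
    _ ≤ ∑ h ∈ H.filter fun h => c / m < risk P h, ENNReal.ofReal (Real.exp (-c)) :=
        Finset.sum_le_sum fun h hh => pi_forall_notMem_errSet_le hm P
          (hmeas h (mem_filter.1 hh).1) (mem_filter.1 hh).2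
    _ ≤ ∑ h ∈ H, ENNReal.ofReal (Real.exp (-c)) :=
        Finset.sum_le_sum_of_subset (filter_subset _ _)
    _ = ENNReal.ofReal δ := by
        rw [Finset.sum_const, nsmul_eq_mul, ← ENNReal.ofReal_natCast,
          ← ENNReal.ofReal_mul hcard.le, hexp, mul_div_cancel₀ _ hcard.ne']

/-- Realizable bound under distribution drift (Corollary 4.4 of the paper). -/
theorem realizable_bound_drift {n k : ℕ} (hk : 1 ≤ k) (hkn : k < n)
    (P₁ P₂ : Measure (X × Y)) [IsProbabilityMeasure P₁] [IsProbabilityMeasure P₂]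
    (H : Finset (X → Y)) (hH : H.Nonempty)
    (hmeas : ∀ h ∈ H, MeasurableSet (errSet h))
    (hreal₁ : ∃ h₁ ∈ H, risk P₁ h₁ = 0) (hreal₂ : ∃ h₂ ∈ H, risk P₂ h₂ = 0)
    (erm₁ : (Fin k → X × Y) → (X → Y)) (herm₁M : MeasurableERM erm₁) (herm₁ : IsERM H erm₁)
    (erm₂ : (Fin (n - k) → X × Y) → (X → Y)) (herm₂M : MeasurableERM erm₂)
    (herm₂ : IsERM H erm₂)
    (δ : ℝ) (hδ : δ ∈ Set.Ioo (0 : ℝ) 1) :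
    ((Measure.pi fun _ : Fin k => P₁).prod (Measure.pi fun _ : Fin (n - k) => P₂))
        {p | risk P₁ (erm₁ p.1) + risk P₂ (erm₂ p.2)
          ≤ (Real.log H.card + Real.log (1 / δ)) * n / (k * ((n : ℝ) - k))}
      ≥ ENNReal.ofReal (1 - 2 * δ) := by
  obtain ⟨hδ₀, -⟩ := hδ
  set c := Real.log H.card + Real.log (1 / δ)
  set μ₁ := Measure.pi fun _ : Fin k => P₁
  set μ₂ := Measure.pi fun _ : Fin (n - k) => P₂
  have hbad₁ : μ₁ {s | c / k < risk P₁ (erm₁ s)} ≤ ENNReal.ofReal δ :=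
    herm₁.pi_lt_risk_le hk P₁ hmeas hreal₁ hδ₀
  have hbad₂ : μ₂ {s | c / (n - k : ℕ) < risk P₂ (erm₂ s)} ≤ ENNReal.ofReal δ :=
    herm₂.pi_lt_risk_le (Nat.sub_pos_of_lt hkn) P₂ hmeas hreal₂ hδ₀
  rw [Nat.cast_sub hkn.le] at hbad₂
  have hk' : (0 : ℝ) < k := by exact_mod_cast hk
  have hkn' : (0 : ℝ) < n - k := sub_pos.2 (by exact_mod_cast hkn)
  have hsum : c * n / (k * ((n : ℝ) - k)) = c / k + c / (n - k) := by
    field_simp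
    ring
  set G := {p : (Fin k → X × Y) × (Fin (n - k) → X × Y) |
    risk P₁ (erm₁ p.1) + risk P₂ (erm₂ p.2) ≤ c * n / (k * ((n : ℝ) - k))} with hG
  have hcompl : (μ₁.prod μ₂) Gᶜ ≤ ENNReal.ofReal (2 * δ) := by
    calc (μ₁.prod μ₂) Gᶜ
        ≤ (μ₁.prod μ₂) ({s | c / k < risk P₁ (erm₁ s)} ×ˢ Set.univ ∪
            Set.univ ×ˢ {s | c / ((n : ℝ) - k) < risk P₂ (erm₂ s)}) := by
          refine measure_mono fun p hp => ?_
          simp only [hG, Set.mem_compl_iff, Set.mem_ofPred_eq, not_le, hsum] at hp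
          simp only [Set.mem_union, Set.mem_prod, Set.mem_ofPred_eq, Set.mem_univ, and_true,
            true_and]
          by_contra! hle
          linarith [hle.1, hle.2]
      _ ≤ ENNReal.ofReal δ + ENNReal.ofReal δ := by
          refine (measure_union_le _ _).trans ?_
          rw [Measure.prod_prod, Measure.prod_prod, measure_univ, measure_univ, mul_one, one_mul]
          exact add_le_add hbad₁ hbad₂
      _ = ENNReal.ofReal (2 * δ) := by rw [← ENNReal.ofReal_add hδ₀.le hδ₀.le, two_mul]
  rw [ge_iff_le, ENNReal.ofReal_sub _ (by positivity), ENNReal.ofReal_one, tsub_le_iff_right]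
  calc 1 = (μ₁.prod μ₂) (G ∪ Gᶜ) := by rw [Set.union_compl_self, measure_univ]
    _ ≤ (μ₁.prod μ₂) G + ENNReal.ofReal (2 * δ) :=
        (measure_union_le _ _).trans (by gcongr)
end

section
/- Let P be a probability measure on Z, let H be a finite nonempty hypothesis class with measurable error sets, let ĥ be an empirical risk minimizer on samples of size n ≥ 1, and let h* ∈ H minimize L_P over H. Then for every ε > 0, P^{⊗n}({s ∈ Z^n : L_P(ĥ(s)) − L_P(h*) > ε}) ≤ 2|H| · exp(−n ε²/2). -/
open MeasureTheory Finset
open scoped ENNReal NNReal Classical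

variable {X Y : Type*}

variable [MeasurableSpace X] [MeasurableSpace Y]

open ProbabilityTheory

/-- Hoeffding's inequality for the sample mean of a function with values in an interval of
length one. -/
theorem pi_real_mul_le_sum_sub_integral_le {Z : Type*} [MeasurableSpace Z] {n : ℕ} (hn : 1 ≤ n)
    (P : Measure Z) [IsProbabilityMeasure P] {f : Z → ℝ} (hf : Measurable f) {a : ℝ}
    (hfa : ∀ z, f z ∈ Set.Icc a (a + 1)) {t : ℝ} (ht : 0 ≤ t) :
    (Measure.pi fun _ : Fin n => P).real {s | n * t ≤ ∑ i, (f (s i) - ∫ z, f z ∂P)}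
      ≤ Real.exp (-2 * n * t ^ 2) := by
  have hindep : iIndepFun (fun (i : Fin n) (s : Fin n → Z) => f (s i) - ∫ z, f z ∂P)
      (Measure.pi fun _ : Fin n => P) :=
    iIndepFun_pi (X := fun _ z => f z - ∫ z, f z ∂P) fun _ => (hf.sub_const _).aemeasurable
  have hsub : ∀ i ∈ (Finset.univ : Finset (Fin n)),
      HasSubgaussianMGF (fun s : Fin n → Z => f (s i) - ∫ z, f z ∂P) ((‖a + 1 - a‖₊ / 2) ^ 2)
        (Measure.pi fun _ : Fin n => P) := by
    intro i _
    have hmp := measurePreserving_eval (fun _ : Fin n => P) i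
    refine HasSubgaussianMGF.of_map (X := fun z => f z - ∫ z, f z ∂P) hmp.measurable.aemeasurable ?_
    rw [hmp.map_eq]
    exact hasSubgaussianMGF_of_mem_Icc hf.aemeasurable (ae_of_all _ hfa)
  refine (HasSubgaussianMGF.measure_sum_ge_le_of_iIndepFun hindep hsub
    (mul_nonneg n.cast_nonneg ht)).trans_eq ?_
  have hn' : (n : ℝ) ≠ 0 := by positivity
  congr 1
  simp
  field_simp

theorem integral_indicator_errSet_eq_risk {P : Measure (X × Y)} {h : X → Y}
    (hm : MeasurableSet (errSet h)) : ∫ z, (errSet h).indicator 1 z ∂P = risk P h := by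
  rw [integral_indicator_one hm]
  rfl

omit [MeasurableSpace X] [MeasurableSpace Y] in
theorem sum_indicator_errSet_eq_mul_empRisk {n : ℕ} (hn : 1 ≤ n) (s : Fin n → X × Y)
    (h : X → Y) : ∑ i, (errSet h).indicator (1 : X × Y → ℝ) (s i) = n * empRisk s h := by
  have hn' : (n : ℝ) ≠ 0 := by positivity
  rw [empRisk, mul_div_cancel₀ _ hn']
  rw [Finset.card_filter, Nat.cast_sum]
  exact Finset.sum_congr rfl fun i _ => by simp [Set.indicator_apply, errSet]

theorem indicator_one_mem_Icc {Z : Type*} (A : Set Z) (z : Z) :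
    A.indicator (1 : Z → ℝ) z ∈ Set.Icc (0 : ℝ) 1 := by
  by_cases hz : z ∈ A <;> simp [hz]

theorem pi_real_le_empRisk_sub_risk_le {n : ℕ} (hn : 1 ≤ n) (P : Measure (X × Y))
    [IsProbabilityMeasure P] {h : X → Y} (hm : MeasurableSet (errSet h)) {t : ℝ} (ht : 0 ≤ t) :
    (Measure.pi fun _ : Fin n => P).real {s | t ≤ empRisk s h - risk P h}
      ≤ Real.exp (-2 * n * t ^ 2) := by
  have hn' : (0 : ℝ) < n := by positivity
  convert pi_real_mul_le_sum_sub_integral_le hn P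
    (measurable_one.indicator hm : Measurable ((errSet h).indicator (1 : X × Y → ℝ)))
    (a := 0) (fun z => by simpa using indicator_one_mem_Icc (errSet h) z) ht using 4 with s
  rw [integral_indicator_errSet_eq_risk hm, Finset.sum_sub_distrib,
    sum_indicator_errSet_eq_mul_empRisk hn, Finset.sum_const, Finset.card_univ, Fintype.card_fin,
    nsmul_eq_mul, ← mul_sub, mul_le_mul_iff_right₀ hn']

theorem pi_real_le_risk_sub_empRisk_le {n : ℕ} (hn : 1 ≤ n) (P : Measure (X × Y))
    [IsProbabilityMeasure P] {h : X → Y} (hm : MeasurableSet (errSet h)) {t : ℝ} (ht : 0 ≤ t) :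
    (Measure.pi fun _ : Fin n => P).real {s | t ≤ risk P h - empRisk s h}
      ≤ Real.exp (-2 * n * t ^ 2) := by
  have hn' : (0 : ℝ) < n := by positivity
  convert pi_real_mul_le_sum_sub_integral_le hn P
    (measurable_one.indicator hm : Measurable ((errSet h).indicator (1 : X × Y → ℝ))).neg
    (a := -1) (fun z => by
      simpa [and_comm] using indicator_one_mem_Icc (errSet h) z) ht using 4 with s
  simp only [Pi.neg_apply]
  rw [integral_neg, integral_indicator_errSet_eq_risk hm, Finset.sum_sub_distrib,
    Finset.sum_neg_distrib, sum_indicator_errSet_eq_mul_empRisk hn, Finset.sum_const,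
    Finset.card_univ, Fintype.card_fin, nsmul_eq_mul, ← mul_neg, ← mul_sub,
    mul_le_mul_iff_right₀ hn', neg_sub_neg]

/-- Agnostic bound for a finite hypothesis class, exponential form. -/
theorem agnostic_bound_exp {n : ℕ} (hn : 1 ≤ n)
    (P : Measure (X × Y)) [IsProbabilityMeasure P]
    (H : Finset (X → Y)) (hH : H.Nonempty)
    (hmeas : ∀ h ∈ H, MeasurableSet (errSet h))
    (erm : (Fin n → X × Y) → (X → Y)) (hermM : MeasurableERM erm) (herm : IsERM H erm)
    (hstar : X → Y) (hstarH : hstar ∈ H) (hstarmin : ∀ h ∈ H, risk P hstar ≤ risk P h)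
    (ε : ℝ) (hε : 0 < ε) :
    (Measure.pi fun _ : Fin n => P) {s | risk P (erm s) - risk P hstar > ε}
      ≤ 2 * (H.card : ℝ≥0∞) * ENNReal.ofReal (Real.exp (-(n : ℝ) * ε ^ 2 / 2)) := by
  set μ := Measure.pi fun _ : Fin n => P
  have hε2 : 0 ≤ ε / 2 := by positivity
  have hexp : -2 * (n : ℝ) * (ε / 2) ^ 2 = -(n : ℝ) * ε ^ 2 / 2 := by ring
  set e := Real.exp (-(n : ℝ) * ε ^ 2 / 2)
  have hover : ∀ h ∈ H, μ {s | ε / 2 ≤ risk P h - empRisk s h} ≤ ENNReal.ofReal e := by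
    intro h hh
    rw [ENNReal.le_ofReal_iff_toReal_le (measure_ne_top _ _) (Real.exp_pos _).le]
    simpa only [hexp, measureReal_def] using pi_real_le_risk_sub_empRisk_le hn P (hmeas h hh) hε2
  have hunder : μ {s | ε / 2 ≤ empRisk s hstar - risk P hstar} ≤ ENNReal.ofReal e := by
    rw [ENNReal.le_ofReal_iff_toReal_le (measure_ne_top _ _) (Real.exp_pos _).le]
    simpa only [hexp, measureReal_def] using pi_real_le_empRisk_sub_risk_le hn P (hmeas hstar hstarH) hε2
  have hcover : {s | risk P (erm s) - risk P hstar > ε} ⊆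
      (⋃ h ∈ H, {s : Fin n → X × Y | ε / 2 ≤ risk P h - empRisk s h}) ∪
        {s | ε / 2 ≤ empRisk s hstar - risk P hstar} := by
    intro s hs
    obtain ⟨hermH, hmin⟩ := herm s
    have hle := hmin hstar hstarH
    simp only [Set.mem_ofPred_eq, Set.mem_union, Set.mem_iUnion] at hs ⊢
    by_contra! hc
    linarith [hc.1 _ hermH, hc.2]
  have hcard : (1 : ℝ≥0∞) ≤ H.card := by exact_mod_cast hH.card_pos
  calc μ {s | risk P (erm s) - risk P hstar > ε}
      ≤ ∑ h ∈ H, μ {s | ε / 2 ≤ risk P h - empRisk s h} +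
          μ {s | ε / 2 ≤ empRisk s hstar - risk P hstar} :=
        (measure_mono hcover).trans <| (measure_union_le _ _).trans <|
          add_le_add_left (measure_biUnion_finset_le _ _) _
    _ ≤ H.card * ENNReal.ofReal e + 1 * ENNReal.ofReal e := by
        rw [one_mul, ← nsmul_eq_mul]
        exact add_le_add (Finset.sum_le_card_nsmul _ _ _ hover) hunder
    _ ≤ 2 * (H.card : ℝ≥0∞) * ENNReal.ofReal e := by
        rw [← add_mul, two_mul]
        gcongr
end

section
/- Let P be a probability measure on Z, let H be a finite nonempty hypothesis class with measurable error sets, let ĥ be an empirical risk minimizer on samples of size n ≥ 1, and let h* ∈ H minimize L_P over H. Then for every δ ∈ (0,1), P^{⊗n}({s ∈ Z^n : L_P(ĥ(s)) − L_P(h*) ≤ √(2(log|H| + log(2/δ))/n)}) ≥ 1 − δ. -/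
open MeasureTheory Finset
open scoped ENNReal NNReal Classical

variable {X Y : Type*}

variable [MeasurableSpace X] [MeasurableSpace Y]

open ProbabilityTheory

/-- The deviation of the empirical risk of `h` from its expected risk is sub-Gaussian. -/
lemma hasSubgaussianMGF_empRisk_sub_risk {n : ℕ} (hn : n ≠ 0) (P : Measure (X × Y))
    [IsProbabilityMeasure P] {h : X → Y} (hh : MeasurableSet (errSet h)) :
    HasSubgaussianMGF (fun s : Fin n → X × Y => n * (empRisk s h - risk P h)) (n / 4)
      (Measure.pi fun _ => P) := by
  set f : X × Y → ℝ := fun z => (errSet h).indicator 1 z - P.real (errSet h) with hf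
  have hf_meas : Measurable f := (measurable_one.indicator hh).sub_const _
  have hf_subG : HasSubgaussianMGF f (1 / 4) P := by
    have hI : ∀ᵐ z ∂P, (errSet h).indicator (1 : X × Y → ℝ) z ∈ Set.Icc (0 : ℝ) 1 :=
      ae_of_all _ fun z => by by_cases hz : z ∈ errSet h <;> simp [hz]
    convert! hasSubgaussianMGF_of_mem_Icc (measurable_one.indicator hh).aemeasurable hI using 1
    · rw [integral_indicator_one hh]
    · ext; norm_num
  have h_indep : iIndepFun (fun (i : Fin n) s => f (s i)) (Measure.pi fun _ : Fin n => P) :=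
    iIndepFun_pi fun _ => hf_meas.aemeasurable
  have h_sum := HasSubgaussianMGF.sum_of_iIndepFun h_indep (c := fun _ => 1 / 4) (s := univ)
    fun i _ => HasSubgaussianMGF.of_map (X := f) (measurable_pi_apply i).aemeasurable (by
      rwa [(measurePreserving_eval (fun _ : Fin n => P) i).map_eq])
  convert! h_sum using 1
  · ext s
    have hcard : ∑ i, (errSet h).indicator (1 : X × Y → ℝ) (s i)
        = (univ.filter fun i => (s i).2 ≠ h (s i).1).card := by
      rw [card_filter]
      simp [Set.indicator_apply, errSet, Nat.cast_sum, ite_not]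
    simp only [hf, sum_sub_distrib, hcard, empRisk, risk, Measure.real]
    have : (n : ℝ) ≠ 0 := mod_cast hn
    simp
    field_simp
  · simp [div_eq_mul_inv]

/-- **Hoeffding's inequality** for the empirical risk of a fixed hypothesis. -/
lemma measureReal_le_abs_empRisk_sub_risk {n : ℕ} (hn : n ≠ 0) (P : Measure (X × Y))
    [IsProbabilityMeasure P] {h : X → Y} (hh : MeasurableSet (errSet h)) {ε : ℝ} (hε : 0 ≤ ε) :
    (Measure.pi fun _ : Fin n => P).real {s | ε ≤ |empRisk s h - risk P h|}
      ≤ 2 * Real.exp (-2 * n * ε ^ 2) := by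
  have hn0 : (0 : ℝ) < n := by positivity
  have hX := hasSubgaussianMGF_empRisk_sub_risk hn P hh
  have h_exp : -(n * ε) ^ 2 / (2 * ((n / 4 : ℝ≥0) : ℝ)) = -2 * n * ε ^ 2 := by
    push_cast; field_simp; norm_num
  have h_upper := hX.measure_ge_le (mul_nonneg hn0.le hε)
  have h_lower := hX.neg.measure_ge_le (mul_nonneg hn0.le hε)
  rw [h_exp] at h_upper h_lower
  rw [two_mul]
  refine (measureReal_mono ?_).trans ((measureReal_union_le _ _).trans (add_le_add h_upper h_lower))
  intro s hs
  rcases le_abs.1 (show ε ≤ |empRisk s h - risk P h| from hs) with hs | hs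
  · exact Or.inl (mul_le_mul_of_nonneg_left hs hn0.le)
  · refine Or.inr ?_
    change n * ε ≤ -(n * (empRisk s h - risk P h))
    rw [← mul_neg]
    exact mul_le_mul_of_nonneg_left hs hn0.le

/-- Uniform convergence of the empirical risk over a finite hypothesis class. -/
lemma measureReal_exists_le_abs_empRisk_sub_risk {n : ℕ} (hn : n ≠ 0) (P : Measure (X × Y))
    [IsProbabilityMeasure P] {H : Finset (X → Y)} (hmeas : ∀ h ∈ H, MeasurableSet (errSet h))
    {ε : ℝ} (hε : 0 ≤ ε) :
    (Measure.pi fun _ : Fin n => P).real {s | ∃ h ∈ H, ε ≤ |empRisk s h - risk P h|}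
      ≤ 2 * H.card * Real.exp (-2 * n * ε ^ 2) := by
  have h_union : {s : Fin n → X × Y | ∃ h ∈ H, ε ≤ |empRisk s h - risk P h|}
      = ⋃ h ∈ H, {s | ε ≤ |empRisk s h - risk P h|} := by ext; simp
  rw [h_union]
  refine (measureReal_biUnion_finset_le _ _).trans ((sum_le_card_nsmul _ _ _ fun h hh =>
    measureReal_le_abs_empRisk_sub_risk hn P (hmeas h hh) hε).trans_eq ?_)
  rw [nsmul_eq_mul]
  ring

/-- Agnostic PAC bound for a finite hypothesis class. -/
theorem agnostic_pac_bound {n : ℕ} (hn : 1 ≤ n)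
    (P : Measure (X × Y)) [IsProbabilityMeasure P]
    (H : Finset (X → Y)) (hH : H.Nonempty)
    (hmeas : ∀ h ∈ H, MeasurableSet (errSet h))
    (erm : (Fin n → X × Y) → (X → Y)) (hermM : MeasurableERM erm) (herm : IsERM H erm)
    (hstar : X → Y) (hstarH : hstar ∈ H) (hstarmin : ∀ h ∈ H, risk P hstar ≤ risk P h)
    (δ : ℝ) (hδ : δ ∈ Set.Ioo (0 : ℝ) 1) :
    (Measure.pi fun _ : Fin n => P)
        {s | risk P (erm s) - risk P hstar
          ≤ Real.sqrt (2 * (Real.log H.card + Real.log (2 / δ)) / n)}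
      ≥ ENNReal.ofReal (1 - δ) := by
  have hδ0 : 0 < δ := hδ.1
  have hn0 : (0 : ℝ) < n := by exact_mod_cast hn
  have hH0 : (0 : ℝ) < H.card := by exact_mod_cast hH.card_pos
  have hH1 : (1 : ℝ) ≤ H.card := by exact_mod_cast hH.card_pos
  have h_log : 0 ≤ Real.log H.card + Real.log (2 / δ) :=
    add_nonneg (Real.log_nonneg hH1)
      (Real.log_nonneg ((one_le_div hδ0).2 (by linarith [hδ.2])))
  set r := Real.sqrt (2 * (Real.log H.card + Real.log (2 / δ)) / n) with hr
  have hr_sq : r ^ 2 = 2 * (Real.log H.card + Real.log (2 / δ)) / n :=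
    Real.sq_sqrt (by positivity)
  have h_exp : 2 * H.card * Real.exp (-2 * n * (r / 2) ^ 2) = δ := by
    have h_arg : -2 * n * (r / 2) ^ 2 = -Real.log (H.card * (2 / δ)) := by
      rw [div_pow, hr_sq, Real.log_mul hH0.ne' (by positivity)]
      field_simp
    rw [h_arg, Real.exp_neg, Real.exp_log (by positivity)]
    field_simp
  have h_bad := measureReal_exists_le_abs_empRisk_sub_risk (n := n) (by omega) P hmeas
    (ε := r / 2) (by positivity)
  rw [h_exp] at h_bad
  set G := {s | risk P (erm s) - risk P hstar ≤ r}
  have h_compl : Gᶜ ⊆ {s | ∃ h ∈ H, r / 2 ≤ |empRisk s h - risk P h|} := by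
    intro s hs
    by_contra! h_close
    simp only [Set.mem_ofPred_eq, not_exists, not_and, not_le] at h_close
    refine hs ?_
    have h_erm := abs_lt.1 (h_close _ (herm s).1)
    have h_star := abs_lt.1 (h_close _ hstarH)
    have h_min := (herm s).2 _ hstarH
    change risk P (erm s) - risk P hstar ≤ r
    linarith
  have h_total : 1 ≤ (Measure.pi fun _ : Fin n => P).real G
      + (Measure.pi fun _ : Fin n => P).real Gᶜ := by
    simpa using measureReal_union_le (μ := Measure.pi fun _ : Fin n => P) G Gᶜ
  refine ENNReal.ofReal_le_of_le_toReal ?_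
  change 1 - δ ≤ (Measure.pi fun _ : Fin n => P).real G
  linarith [measureReal_mono (μ := Measure.pi fun _ : Fin n => P) h_compl]
end

section
/- Let P, Q be probability measures on Z with d_TV(P,Q) ≤ η for some η > 0, let H be a finite nonempty hypothesis class with measurable error sets, let ĥ be an empirical risk minimizer on samples of size n ≥ 1 drawn i.i.d. from P, and let h* ∈ H minimize L_P over H. Then for every δ ∈ (0,1), P^{⊗n}({s ∈ Z^n : L_Q(ĥ(s)) − L_P(h*) ≤ √(2(log|H| + log(2/δ))/n) + η}) ≥ 1 − δ. -/
open MeasureTheory Finset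
open scoped ENNReal NNReal Classical

variable {X Y : Type*}

variable [MeasurableSpace X] [MeasurableSpace Y]

open ProbabilityTheory

lemma abs_measure_toReal_sub_le_dTV {Z : Type*} [MeasurableSpace Z] (P Q : Measure Z)
    [IsProbabilityMeasure P] [IsProbabilityMeasure Q] {A : Set Z} (hA : MeasurableSet A) :
    |(P A).toReal - (Q A).toReal| ≤ dTV P Q := by
  refine le_ciSup (f := fun A : {A : Set Z // MeasurableSet A} =>
    |(P A.1).toReal - (Q A.1).toReal|) ⟨1, ?_⟩ ⟨A, hA⟩
  rintro _ ⟨B, rfl⟩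
  have hP : (P B.1).toReal ≤ 1 := measureReal_le_one
  have hQ : (Q B.1).toReal ≤ 1 := measureReal_le_one
  have hP0 : 0 ≤ (P B.1).toReal := ENNReal.toReal_nonneg
  have hQ0 : 0 ≤ (Q B.1).toReal := ENNReal.toReal_nonneg
  exact abs_le.2 ⟨by linarith, by linarith⟩

/-- Hoeffding's inequality for an i.i.d. sample and a function with values in `[a, b]`. -/
lemma measureReal_pi_sum_sub_integral_ge_le {Z : Type*} [MeasurableSpace Z] (P : Measure Z)
    [IsProbabilityMeasure P] (n : ℕ) {f : Z → ℝ} (hf : Measurable f) {a b : ℝ}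
    (hab : ∀ z, f z ∈ Set.Icc a b) {ε : ℝ} (hε : 0 ≤ ε) :
    (Measure.pi fun _ : Fin n => P).real {s | ε ≤ ∑ i, (f (s i) - ∫ z, f z ∂P)}
      ≤ Real.exp (-2 * ε ^ 2 / (n * (b - a) ^ 2)) := by
  have hindep : iIndepFun (fun (i : Fin n) (s : Fin n → Z) => f (s i) - ∫ z, f z ∂P)
      (Measure.pi fun _ : Fin n => P) :=
    iIndepFun_pi (X := fun (_ : Fin n) (z : Z) => f z - ∫ z, f z ∂P)
      fun _ => (hf.sub_const _).aemeasurable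
  have hsub (i : Fin n) : HasSubgaussianMGF (fun s : Fin n → Z => f (s i) - ∫ z, f z ∂P)
      ((‖b - a‖₊ / 2) ^ 2) (Measure.pi fun _ : Fin n => P) := by
    refine HasSubgaussianMGF.of_map (Y := fun s : Fin n → Z => s i)
      (X := fun z : Z => f z - ∫ z, f z ∂P)
      (measurable_pi_apply i).aemeasurable ?_
    rw [(measurePreserving_eval (fun _ : Fin n => P) i).map_eq]
    exact hasSubgaussianMGF_of_mem_Icc hf.aemeasurable (ae_of_all _ hab)
  refine (HasSubgaussianMGF.measure_sum_ge_le_of_iIndepFun hindep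
    (fun i _ => hsub i) hε).trans_eq ?_
  congr 1
  simp only [sum_const, card_univ, Fintype.card_fin, nsmul_eq_mul, NNReal.coe_mul,
    NNReal.coe_natCast, NNReal.coe_pow, NNReal.coe_div, coe_nnnorm, NNReal.coe_ofNat,
    Real.norm_eq_abs, div_pow, sq_abs]
  field_simp

lemma mul_empRisk_sub_risk_eq_sum {n : ℕ} (hn : n ≠ 0) (P : Measure (X × Y)) {h : X → Y}
    (hh : MeasurableSet (errSet h)) (s : Fin n → X × Y) :
    n * (empRisk s h - risk P h)
      = ∑ i, ((errSet h).indicator 1 (s i) - ∫ z, (errSet h).indicator (1 : X × Y → ℝ) z ∂P) := by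
  rw [sum_sub_distrib, integral_indicator_one hh, sum_const, card_univ, Fintype.card_fin,
    nsmul_eq_mul, mul_sub]
  congr 1
  rw [empRisk, mul_div_cancel₀ _ (Nat.cast_ne_zero.2 hn), card_filter, Nat.cast_sum]
  refine sum_congr rfl fun i _ => ?_
  simp [errSet, Set.indicator_apply]

/-- Two-sided Hoeffding bound for the empirical risk of a single hypothesis. -/
lemma measureReal_abs_empRisk_sub_risk_ge_le {n : ℕ} (hn : n ≠ 0) (P : Measure (X × Y))
    [IsProbabilityMeasure P] {h : X → Y} (hh : MeasurableSet (errSet h)) {t : ℝ} (ht : 0 ≤ t) :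
    (Measure.pi fun _ : Fin n => P).real {s | t ≤ |empRisk s h - risk P h|}
      ≤ 2 * Real.exp (-2 * n * t ^ 2) := by
  have hn0 : (0 : ℝ) < n := by positivity
  set f : X × Y → ℝ := (errSet h).indicator 1 with hf
  have hfm : Measurable f := measurable_one.indicator hh
  have hf01 (z) : f z ∈ Set.Icc (0 : ℝ) 1 := by
    by_cases hz : z ∈ errSet h <;> simp [hf, hz]
  have hexp (b a : ℝ) (hba : b - a = 1) :
      -2 * (n * t) ^ 2 / (n * (b - a) ^ 2) = -2 * n * t ^ 2 := by
    rw [hba]; field_simp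
  have hupper := measureReal_pi_sum_sub_integral_ge_le P n hfm hf01
    (mul_nonneg hn0.le ht)
  have hlower := measureReal_pi_sum_sub_integral_ge_le P n hfm.neg (a := -1) (b := 0)
    (fun z => ⟨neg_le_neg (hf01 z).2, neg_nonpos.2 (hf01 z).1⟩) (mul_nonneg hn0.le ht)
  rw [hexp _ _ (by norm_num)] at hupper hlower
  rw [two_mul]
  refine (measureReal_mono ?_).trans ((measureReal_union_le _ _).trans (add_le_add hupper hlower))
  intro s hs
  have hsum := mul_empRisk_sub_risk_eq_sum hn P hh s
  rcases le_abs.1 hs.out with h | h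
  · left
    rw [Set.mem_ofPred_eq, ← hsum]
    gcongr
  · right
    simp only [Set.mem_ofPred_eq, Pi.neg_apply, integral_neg, neg_sub_neg]
    rw [← neg_le_neg_iff, ← sum_neg_distrib]
    simp only [neg_sub]
    rw [← hsum, le_neg, ← mul_neg]
    gcongr

/-- Uniform convergence of the empirical risk over a finite hypothesis class. -/
lemma measureReal_exists_abs_empRisk_sub_risk_ge_le {n : ℕ} (hn : n ≠ 0) (P : Measure (X × Y))
    [IsProbabilityMeasure P] {H : Finset (X → Y)} (hmeas : ∀ h ∈ H, MeasurableSet (errSet h))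
    {t : ℝ} (ht : 0 ≤ t) :
    (Measure.pi fun _ : Fin n => P).real {s | ∃ h ∈ H, t ≤ |empRisk s h - risk P h|}
      ≤ H.card * (2 * Real.exp (-2 * n * t ^ 2)) := by
  have hset : {s : Fin n → X × Y | ∃ h ∈ H, t ≤ |empRisk s h - risk P h|}
      = ⋃ h ∈ H, {s | t ≤ |empRisk s h - risk P h|} := by
    ext s; simp
  rw [hset, ← nsmul_eq_mul]
  exact (measureReal_biUnion_finset_le _ _).trans (sum_le_card_nsmul _ _ _ fun h hh =>
    measureReal_abs_empRisk_sub_risk_ge_le hn P (hmeas h hh) ht)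


/-- Agnostic PAC bound evaluated at a nearby distribution `Q`. -/
theorem agnostic_pac_bound_tv {n : ℕ} (hn : 1 ≤ n)
    (P Q : Measure (X × Y)) [IsProbabilityMeasure P] [IsProbabilityMeasure Q]
    (η : ℝ) (hη : 0 < η) (hTV : dTV P Q ≤ η)
    (H : Finset (X → Y)) (hH : H.Nonempty)
    (hmeas : ∀ h ∈ H, MeasurableSet (errSet h))
    (erm : (Fin n → X × Y) → (X → Y)) (hermM : MeasurableERM erm) (herm : IsERM H erm)
    (hstar : X → Y) (hstarH : hstar ∈ H) (hstarmin : ∀ h ∈ H, risk P hstar ≤ risk P h)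
    (δ : ℝ) (hδ : δ ∈ Set.Ioo (0 : ℝ) 1) :
    (Measure.pi fun _ : Fin n => P)
        {s | risk Q (erm s) - risk P hstar
          ≤ Real.sqrt (2 * (Real.log H.card + Real.log (2 / δ)) / n) + η}
      ≥ ENNReal.ofReal (1 - δ) := by
  have hn0 : n ≠ 0 := by lia
  have hnpos : (0 : ℝ) < n := by positivity
  have hc : (1 : ℝ) ≤ H.card := by exact_mod_cast hH.card_pos
  have hδ0 := hδ.1
  have hL : 0 ≤ Real.log H.card + Real.log (2 / δ) :=
    add_nonneg (Real.log_nonneg hc)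
      (Real.log_nonneg (by rw [le_div_iff₀ hδ0]; linarith [hδ.2]))
  set L := Real.log H.card + Real.log (2 / δ) with hLdef
  set r := Real.sqrt (2 * L / n) with hr
  have hr2 : r ^ 2 = 2 * L / n := Real.sq_sqrt (by positivity)
  have hbad := measureReal_exists_abs_empRisk_sub_risk_ge_le hn0 P hmeas
    (t := r / 2) (by positivity)
  have hexp : -2 * n * (r / 2) ^ 2 = -L := by
    rw [div_pow, hr2]; field_simp
  have hδeq : H.card * (2 * Real.exp (-L)) = δ := by
    rw [Real.exp_neg, hLdef, Real.exp_add, Real.exp_log (by linarith),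
      Real.exp_log (by positivity)]
    field_simp
  rw [hexp, hδeq] at hbad
  set S := {s : Fin n → X × Y | risk Q (erm s) - risk P hstar ≤ r + η} with hS
  have hsub : Sᶜ ⊆ {s | ∃ h ∈ H, r / 2 ≤ |empRisk s h - risk P h|} := by
    intro s hs
    by_contra! hgood
    simp only [Set.mem_ofPred_eq, not_exists, not_and, not_le] at hgood
    have hQ := (abs_measure_toReal_sub_le_dTV P Q (hmeas _ (herm s).1)).trans hTV
    have h1 := abs_lt.1 (hgood _ (herm s).1)
    have h2 := abs_lt.1 (hgood _ hstarH)
    have h3 := (herm s).2 _ hstarH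
    have h4 : risk P (erm s) - risk Q (erm s) ≥ -η := (abs_le.1 hQ).1
    exact hs (show risk Q (erm s) - risk P hstar ≤ r + η by linarith)
  have hSc : (Measure.pi fun _ : Fin n => P).real Sᶜ ≤ δ := (measureReal_mono hsub).trans hbad
  have hone : 1 ≤ (Measure.pi fun _ : Fin n => P).real S
      + (Measure.pi fun _ : Fin n => P).real Sᶜ := by
    simpa using measureReal_union_le (μ := Measure.pi fun _ : Fin n => P) S Sᶜ
  exact (ENNReal.ofReal_le_iff_le_toReal (measure_ne_top _ _)).2
    (show 1 - δ ≤ (Measure.pi fun _ : Fin n => P).real S by linarith)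
end

section
/- Let 𝒫 = conv{P_1,…,P_m} be a finitely generated credal set of probability measures on Z, let H be a finite nonempty hypothesis class with measurable error sets, let ĥ be an empirical risk minimizer on samples of size n ≥ 1, and for each probability measure P on Z let h*_P ∈ H minimize L_P over H. Then for every δ ∈ (0,1) and every P ∈ 𝒫, P^{⊗n}({s ∈ Z^n : L_P(ĥ(s)) − L_P(h*_P) ≤ 4·sup_{Q∈𝒫} R_{n,Q}(H) + √(2 log(2/δ)/n)}) ≥ 1 − δ. -/
open MeasureTheory Finset
open scoped ENNReal NNReal Classical

variable {X Y : Type*}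

variable [MeasurableSpace X] [MeasurableSpace Y]

section BoundedSup

variable {α ι : Type*} [Fintype ι] [Nonempty ι] {F : ι → α → ℝ} {C : ℝ}

lemma abs_ciSup_le_of_forall_abs_le (hC : ∀ h a, |F h a| ≤ C) (a : α) : |⨆ h, F h a| ≤ C := by
  refine abs_le.2 ⟨?_, ciSup_le fun h => (abs_le.1 (hC h a)).2⟩
  obtain ⟨h⟩ := ‹Nonempty ι›
  exact (abs_le.1 (hC h a)).1.trans (le_ciSup (f := fun h => F h a) (Set.finite_range _).bddAbove h)

lemma integrable_of_measurable_of_abs_le [MeasurableSpace α] {μ : Measure α} [IsFiniteMeasure μ]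
    {f : α → ℝ} (hf : Measurable f) (hC : ∀ a, |f a| ≤ C) : Integrable f μ :=
  Integrable.of_bound hf.aestronglyMeasurable C (ae_of_all _ hC)

lemma integrable_ciSup [MeasurableSpace α] {μ : Measure α} [IsFiniteMeasure μ]
    (hF : ∀ h, Measurable (F h)) (hC : ∀ h a, |F h a| ≤ C) :
    Integrable (fun a => ⨆ h, F h a) μ :=
  integrable_of_measurable_of_abs_le (Measurable.iSup hF) (abs_ciSup_le_of_forall_abs_le hC)

end BoundedSup

lemma integral_comp_of_measurePreserving {α β : Type*} [MeasurableSpace α] [MeasurableSpace β]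
    {μ : Measure α} {ν : Measure β} {f : α → β} (hf : MeasurePreserving f μ ν) {g : β → ℝ}
    (hg : Measurable g) : ∫ a, g (f a) ∂μ = ∫ b, g b ∂ν := by
  rw [← hf.map_eq, integral_map hf.measurable.aemeasurable hg.aestronglyMeasurable]

section McDiarmid

open ProbabilityTheory

variable {Z : Type*} [MeasurableSpace Z] (P : Measure Z) [IsProbabilityMeasure P]

lemma integral_pi_finSucc {n : ℕ} {f : (Fin (n + 1) → Z) → ℝ} {M : ℝ} (hf : Measurable f)
    (hM : ∀ s, |f s| ≤ M) :
    ∫ s, f s ∂(Measure.pi fun _ => P)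
      = ∫ z, ∫ x, f (Fin.cons z x) ∂(Measure.pi fun _ : Fin n => P) ∂P := by
  have hmp := (measurePreserving_piFinSuccAbove (fun _ : Fin (n + 1) => P) 0).symm
  have key := hmp.integral_comp' (g := f)
  rw [← key, integral_prod]
  · simp [MeasurableEquiv.piFinSuccAbove, Fin.insertNthEquiv]
  · exact integrable_of_measurable_of_abs_le (hf.comp (MeasurableEquiv.measurable _))
      (fun a => hM _)

lemma measurable_finCons {n : ℕ} :
    Measurable fun p : Z × (Fin n → Z) => (Fin.cons p.1 p.2 : Fin (n + 1) → Z) := by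
  refine measurable_pi_iff.2 fun i => ?_
  refine Fin.cases ?_ (fun j => ?_) i
  · simpa using measurable_fst
  · simp only [Fin.cons_succ]
    fun_prop

/-- Moment generating function form of McDiarmid's bounded differences inequality. -/
lemma integral_exp_le_of_bounded_differences {c : ℝ} (hc : 0 ≤ c) (t : ℝ) :
    ∀ {n : ℕ} {f : (Fin n → Z) → ℝ} {M : ℝ}, Measurable f → (∀ s, |f s| ≤ M) →
      (∀ s i z, f (Function.update s i z) - f s ≤ c) →
      ∫ s, Real.exp (t * (f s - ∫ s', f s' ∂(Measure.pi fun _ => P))) ∂(Measure.pi fun _ => P)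
        ≤ Real.exp (n * (c / 2) ^ 2 * t ^ 2 / 2) := by
  intro n
  induction n with
  | zero =>
    intro f M hf hM hd
    have hs : ∀ s, f s = f default := fun s => by rw [Subsingleton.elim s default]
    simp [hs]
  | succ n ih =>
    intro f M hf hM hd
    have hfc : Measurable fun p : Z × (Fin n → Z) => f (Fin.cons p.1 p.2) :=
      hf.comp measurable_finCons
    have hfz : ∀ z, Measurable fun x : Fin n → Z => f (Fin.cons z x) := fun z =>
      hfc.comp (measurable_const.prodMk measurable_id)
    have hiz : ∀ z, Integrable (fun x : Fin n → Z => f (Fin.cons z x)) (Measure.pi fun _ => P) :=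
      fun z => integrable_of_measurable_of_abs_le (hfz z) fun x => hM _
    set g : Z → ℝ := fun z => ∫ x, f (Fin.cons z x) ∂(Measure.pi fun _ : Fin n => P) with hg
    have hgm : Measurable g := hfc.stronglyMeasurable.integral_prod_right'.measurable
    have hgM : ∀ z, |g z| ≤ M := fun z => by
      simpa using norm_integral_le_of_norm_le_const (μ := Measure.pi fun _ : Fin n => P)
        (f := fun x => f (Fin.cons z x)) (ae_of_all _ fun x => hM (Fin.cons z x))
    have hgd : ∀ z z', g z - g z' ≤ c := fun z z' => by
      rw [hg, ← integral_sub (hiz z) (hiz z')]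
      refine (integral_mono ((hiz z).sub (hiz z')) (integrable_const c) fun x => ?_).trans (by simp)
      simpa [Fin.update_cons_zero] using hd (Fin.cons z' x) 0 z
    have hm : ∫ s, f s ∂(Measure.pi fun _ => P) = ∫ z, g z ∂P := integral_pi_finSucc P hf hM
    rw [hm]
    set m := ∫ z, g z ∂P
    have hbd : BddBelow (Set.range g) := ⟨-M, by rintro _ ⟨z, rfl⟩; exact (abs_le.1 (hgM z)).1⟩
    have : Nonempty Z := nonempty_of_isProbabilityMeasure P
    have hsg := hasSubgaussianMGF_of_mem_Icc (μ := P) (a := ⨅ z, g z) (b := (⨅ z, g z) + c)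
      hgm.aemeasurable (ae_of_all _ fun z => ⟨ciInf_le hbd z, by
        rw [← sub_le_iff_le_add]
        exact le_ciInf fun z' => by linarith [hgd z z']⟩)
    have hexpb : ∀ s, |Real.exp (t * (f s - m))| ≤ Real.exp (|t| * (M + |m|)) := fun s => by
      rw [abs_of_pos (Real.exp_pos _)]
      refine Real.exp_le_exp.2 ((le_abs_self _).trans ?_)
      rw [abs_mul]
      gcongr
      exact (abs_sub _ _).trans (by gcongr; exact hM s)
    have hexpm : Measurable fun s => Real.exp (t * (f s - m)) := by fun_prop
    rw [integral_pi_finSucc P hexpm hexpb]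
    have hmgf := hsg.mgf_le t
    simp only [add_sub_cancel_left, mgf, NNReal.coe_pow, NNReal.coe_div, coe_nnnorm,
      Real.norm_of_nonneg hc, NNReal.coe_ofNat] at hmgf
    calc _ ≤ ∫ z, Real.exp (n * (c / 2) ^ 2 * t ^ 2 / 2) * Real.exp (t * (g z - m)) ∂P := by
            refine integral_mono (Integrable.integral_prod_left (integrable_of_measurable_of_abs_le
              (hexpm.comp measurable_finCons) fun p => hexpb _))
              ((hsg.integrable_exp_mul t).const_mul _) fun z => ?_
            have h1 := ih (hfz z) (fun x => hM _) (fun x i z' => by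
              have := hd (Fin.cons z x) i.succ z'
              rwa [← Fin.cons_update] at this)
            calc _ = ∫ x, Real.exp (t * (f (Fin.cons z x) - g z)) * Real.exp (t * (g z - m))
                      ∂(Measure.pi fun _ : Fin n => P) := by
                    congr 1
                    ext x
                    rw [← Real.exp_add]
                    congr 1
                    ring
              _ ≤ _ := by
                    rw [integral_mul_const]
                    gcongr
      _ ≤ Real.exp (n * (c / 2) ^ 2 * t ^ 2 / 2) * Real.exp ((c / 2) ^ 2 * t ^ 2 / 2) := by
            rw [integral_const_mul]
            gcongr
      _ = _ := by
            rw [← Real.exp_add]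
            congr 1
            push_cast
            ring

/-- **McDiarmid's bounded differences inequality** for i.i.d. samples. -/
lemma measureReal_ge_le_of_bounded_differences {c : ℝ} (hc : 0 ≤ c) {n : ℕ}
    {f : (Fin n → Z) → ℝ} {M : ℝ} (hf : Measurable f) (hM : ∀ s, |f s| ≤ M)
    (hd : ∀ s i z, f (Function.update s i z) - f s ≤ c) {ε : ℝ} (hε : 0 ≤ ε) :
    (Measure.pi fun _ : Fin n => P).real {s | ε ≤ f s - ∫ s', f s' ∂(Measure.pi fun _ => P)}
      ≤ Real.exp (-ε ^ 2 / (2 * (n * (c / 2) ^ 2))) := by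
  set m := ∫ s', f s' ∂(Measure.pi fun _ : Fin n => P) with hm
  have h : HasSubgaussianMGF (fun s => f s - m) ⟨n * (c / 2) ^ 2, by positivity⟩
      (Measure.pi fun _ : Fin n => P) := by
    refine ⟨fun t => ?_, fun t => integral_exp_le_of_bounded_differences P hc t hf hM hd⟩
    refine integrable_exp_mul_of_mem_Icc (a := -M - m) (b := M - m) (by fun_prop)
      (ae_of_all _ fun s => ?_)
    have := abs_le.1 (hM s)
    exact ⟨by linarith, by linarith⟩
  exact h.measure_ge_le hε

end McDiarmid

section Symmetrization

variable {Z ι : Type*} [MeasurableSpace Z] [Fintype ι] [Nonempty ι] (P : Measure Z)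
  [IsProbabilityMeasure P] {l : ι → Z → ℝ}

/-- The Rademacher sign attached to a Boolean. -/
noncomputable def boolSign (b : Bool) : ℝ := if b then 1 else -1

lemma abs_boolSign (b : Bool) : |boolSign b| = 1 := by cases b <;> simp [boolSign]

lemma boolSign_not (b : Bool) : boolSign (!b) = -boolSign b := by cases b <;> simp [boolSign]

lemma measurable_boolSign : Measurable boolSign := measurable_of_countable _

lemma abs_sum_div_le {n : ℕ} {a : Fin n → ℝ} {C : ℝ} (hC : 0 ≤ C) (ha : ∀ i, |a i| ≤ C) :
    |(∑ i, a i) / n| ≤ C := by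
  rw [abs_div, Nat.abs_cast]
  refine div_le_of_le_mul₀ (by positivity) hC ((Finset.abs_sum_le_sum_abs _ _).trans ?_)
  refine (Finset.sum_le_sum fun i _ => ha i).trans ?_
  simp [mul_comm]

/-- The uniform measure on sign patterns. -/
noncomputable abbrev signMeasure (n : ℕ) : Measure (Fin n → Bool) :=
  Measure.pi fun _ => (PMF.uniformOfFintype Bool).toMeasure

lemma measurePreserving_not_uniform :
    MeasurePreserving (fun b : Bool => !b) (PMF.uniformOfFintype Bool).toMeasure
      (PMF.uniformOfFintype Bool).toMeasure := by
  refine ⟨measurable_of_countable _, ?_⟩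
  refine Measure.ext_of_singleton fun b => ?_
  rw [Measure.map_apply (measurable_of_countable _) (measurableSet_singleton b)]
  have : (fun b : Bool => !b) ⁻¹' {b} = {!b} := by ext x; cases x <;> cases b <;> simp
  rw [this, PMF.toMeasure_apply_singleton _ _ (measurableSet_singleton _),
    PMF.toMeasure_apply_singleton _ _ (measurableSet_singleton _)]
  simp

lemma integral_ciSup_sub_le (hl : ∀ h, Measurable (l h)) (hb : ∀ h z, |l h z| ≤ 1) {n : ℕ}
    (hn : 1 ≤ n) :
    ∫ s, (⨆ h, (∫ z, l h z ∂P - (∑ i, l h (s i)) / n)) ∂(Measure.pi fun _ : Fin n => P)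
      ≤ ∫ w, (⨆ h, (∑ i, (l h (w i).1 - l h (w i).2)) / n)
          ∂(Measure.pi fun _ : Fin n => P.prod P) := by
  have hn0 : (n : ℝ) ≠ 0 := by positivity
  have h2 : ∀ h z z', |l h z - l h z'| ≤ 2 := fun h z z' =>
    (abs_sub _ _).trans (by linarith [hb h z, hb h z'])
  have hG : ∀ h, Measurable fun q : (Fin n → Z) × (Fin n → Z) =>
      (∑ i, (l h (q.1 i) - l h (q.2 i))) / n := fun h => by
    have := hl h
    fun_prop
  have hGb : ∀ h (q : (Fin n → Z) × (Fin n → Z)),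
      |(∑ i, (l h (q.1 i) - l h (q.2 i))) / n| ≤ 2 := fun h q =>
    abs_sum_div_le zero_le_two fun i => h2 _ _ _
  have hint := integrable_ciSup (μ := (Measure.pi fun _ : Fin n => P).prod
    (Measure.pi fun _ : Fin n => P)) hG hGb
  have hlE : ∀ h, |∫ z, l h z ∂P| ≤ 1 := fun h => by
    simpa using norm_integral_le_of_norm_le_const (μ := P) (f := l h) (ae_of_all _ (hb h))
  have hmp := measurePreserving_arrowProdEquivProdArrow Z Z (Fin n) (fun _ => P) (fun _ => P)
  have key := hmp.integral_comp' (g := fun q => ⨆ h, (∑ i, (l h (q.1 i) - l h (q.2 i))) / n)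
  refine le_trans ?_ key.ge
  rw [integral_prod_symm _ hint]
  refine integral_mono (integrable_ciSup (C := 2) (fun h => ?_) fun h s => ?_)
    hint.integral_prod_right fun s => ciSup_le fun h => ?_
  · have := hl h
    fun_prop
  · refine (abs_sub _ _).trans ?_
    linarith [hlE h, abs_sum_div_le zero_le_one fun i => hb h (s i)]
  · have hle : ∀ i : Fin n, Integrable (fun x : Fin n → Z => l h (x i)) (Measure.pi fun _ => P) :=
      fun i => integrable_of_measurable_of_abs_le ((hl h).comp (measurable_pi_apply i))
        fun x => hb h _
    have hs : ∫ z, l h z ∂P - (∑ i, l h (s i)) / n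
        = ∫ x, (∑ i, (l h (x i) - l h (s i))) / n ∂(Measure.pi fun _ : Fin n => P) := by
      have he : ∀ i : Fin n, ∫ x, l h (x i) ∂(Measure.pi fun _ : Fin n => P) = ∫ z, l h z ∂P :=
        fun i => integral_comp_eval (μ := fun _ : Fin n => P) (i := i)
          (hl h).aestronglyMeasurable
      have hsub : ∀ i : Fin n, Integrable (fun x : Fin n → Z => l h (x i) - l h (s i))
          (Measure.pi fun _ => P) := fun i => (hle i).sub (integrable_const _)
      rw [integral_div, integral_finsetSum _ fun i _ => hsub i]
      simp only [integral_sub (hle _) (integrable_const _), he]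
      simp only [integral_const, probReal_univ, one_smul, Finset.sum_sub_distrib, Finset.sum_const,
        Finset.card_univ, Fintype.card_fin, nsmul_eq_mul]
      field_simp
    rw [hs]
    refine integral_mono (integrable_of_measurable_of_abs_le
      ((hG h).comp (measurable_id.prodMk measurable_const)) fun x => hGb h (x, s))
      (integrable_ciSup (fun h => (hG h).comp (measurable_id.prodMk measurable_const))
        fun h x => hGb h (x, s)) fun x => ?_
    exact le_ciSup (f := fun h => (∑ i, (l h (x i) - l h (s i))) / (n : ℝ))
      (Set.finite_range _).bddAbove h

omit [Nonempty ι] in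
/-- Exchanging the two members of the pairs selected by a sign pattern preserves the law of an
i.i.d. sample of pairs. -/
lemma integral_ciSup_sign_mul_sub (hl : ∀ h, Measurable (l h)) {n : ℕ} (σ : Fin n → Bool) :
    ∫ w, (⨆ h, (∑ i, (l h (w i).1 - l h (w i).2)) / n) ∂(Measure.pi fun _ : Fin n => P.prod P)
      = ∫ w, (⨆ h, (∑ i, boolSign (σ i) * (l h (w i).1 - l h (w i).2)) / n)
          ∂(Measure.pi fun _ : Fin n => P.prod P) := by
  have hmp := measurePreserving_pi (fun _ : Fin n => P.prod P) (fun _ : Fin n => P.prod P)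
    (f := fun i => if σ i then id else Prod.swap) fun i => by
      cases σ i
      · simpa using Measure.measurePreserving_swap
      · simpa using MeasurePreserving.id _
  have hm : Measurable fun w : Fin n → Z × Z =>
      ⨆ h, (∑ i, (l h (w i).1 - l h (w i).2)) / (n : ℝ) :=
    Measurable.iSup fun h => by
      have := hl h
      fun_prop
  rw [← integral_comp_of_measurePreserving hmp hm]
  congr! 6 with w h
  rename_i i _
  cases hi : σ i <;> simp [boolSign, hi]

lemma integral_ciSup_sign_mul_sub_le (hl : ∀ h, Measurable (l h)) (hb : ∀ h z, |l h z| ≤ 1)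
    {n : ℕ} (σ : Fin n → Bool) :
    ∫ w, (⨆ h, (∑ i, boolSign (σ i) * (l h (w i).1 - l h (w i).2)) / n)
        ∂(Measure.pi fun _ : Fin n => P.prod P)
      ≤ ∫ s, (⨆ h, (∑ i, boolSign (σ i) * l h (s i)) / n) ∂(Measure.pi fun _ : Fin n => P)
        + ∫ s, (⨆ h, (∑ i, boolSign (!σ i) * l h (s i)) / n)
            ∂(Measure.pi fun _ : Fin n => P) := by
  have hm : ∀ (τ : Fin n → Bool) (h : ι),
      Measurable fun s : Fin n → Z => (∑ i, boolSign (τ i) * l h (s i)) / n := fun τ h => by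
    have := hl h
    fun_prop
  have hM : ∀ (τ : Fin n → Bool) h (s : Fin n → Z),
      |(∑ i, boolSign (τ i) * l h (s i)) / n| ≤ 1 := fun τ h s =>
    abs_sum_div_le zero_le_one fun i => by rw [abs_mul, abs_boolSign, one_mul]; exact hb _ _
  have h1 := measurePreserving_pi (fun _ : Fin n => P.prod P) (fun _ : Fin n => P)
    (f := fun _ => Prod.fst) fun _ => measurePreserving_fst
  have h2 := measurePreserving_pi (fun _ : Fin n => P.prod P) (fun _ : Fin n => P)
    (f := fun _ => Prod.snd) fun _ => measurePreserving_snd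
  have i1 := integrable_ciSup (μ := Measure.pi fun _ : Fin n => P.prod P)
    (fun h => (hm σ h).comp h1.measurable) fun h w => hM σ h _
  have i2 := integrable_ciSup (μ := Measure.pi fun _ : Fin n => P.prod P)
    (fun h => (hm (fun i => !σ i) h).comp h2.measurable) fun h w => hM (fun i => !σ i) h _
  rw [← integral_comp_of_measurePreserving h1 (Measurable.iSup (hm σ)),
    ← integral_comp_of_measurePreserving h2 (Measurable.iSup (hm fun i => !σ i))]
  refine le_of_le_of_eq ?_ (integral_add i1 i2)
  refine integral_mono (integrable_ciSup (C := 2) (fun h => ?_) fun h w => ?_) (i1.add i2)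
    fun w => ciSup_le fun h => ?_
  · have := hl h
    fun_prop
  · refine abs_sum_div_le zero_le_two fun i => ?_
    rw [abs_mul, abs_boolSign, one_mul]
    exact (abs_sub _ _).trans (by linarith [hb h (w i).1, hb h (w i).2])
  · have e : (∑ i, boolSign (σ i) * (l h (w i).1 - l h (w i).2)) / (n : ℝ)
        = (∑ i, boolSign (σ i) * l h (w i).1) / n + (∑ i, boolSign (!σ i) * l h (w i).2) / n := by
      rw [← add_div, ← Finset.sum_add_distrib]
      congr! 2 with i
      rw [boolSign_not]
      ring
    rw [e]
    exact add_le_add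
      (le_ciSup (f := fun h => (∑ i, boolSign (σ i) * l h (w i).1) / (n : ℝ))
        (Set.finite_range _).bddAbove h)
      (le_ciSup (f := fun h => (∑ i, boolSign (!σ i) * l h (w i).2) / (n : ℝ))
        (Set.finite_range _).bddAbove h)

/-- **Symmetrization**: the expected uniform deviation is at most twice the Rademacher
complexity. -/
lemma integral_ciSup_sub_le_two_mul (hl : ∀ h, Measurable (l h)) (hb : ∀ h z, |l h z| ≤ 1) {n : ℕ}
    (hn : 1 ≤ n) :
    ∫ s, (⨆ h, (∫ z, l h z ∂P - (∑ i, l h (s i)) / n)) ∂(Measure.pi fun _ : Fin n => P)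
      ≤ 2 * ∫ p : (Fin n → Z) × (Fin n → Bool), (⨆ h, (∑ i, boolSign (p.2 i) * l h (p.1 i)) / n)
          ∂((Measure.pi fun _ => P).prod (signMeasure n)) := by
  refine (integral_ciSup_sub_le P hl hb hn).trans ?_
  set D := ∫ w, (⨆ h, (∑ i, (l h (w i).1 - l h (w i).2)) / n)
    ∂(Measure.pi fun _ : Fin n => P.prod P)
  set K : (Fin n → Bool) → ℝ := fun σ =>
    ∫ s, (⨆ h, (∑ i, boolSign (σ i) * l h (s i)) / n) ∂(Measure.pi fun _ : Fin n => P)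
  have hD : ∀ σ, D ≤ K σ + K (fun i => !σ i) := fun σ =>
    (integral_ciSup_sign_mul_sub P hl σ).le.trans (integral_ciSup_sign_mul_sub_le P hl hb σ)
  have hint := integrable_ciSup (C := 1) (μ := (Measure.pi fun _ : Fin n => P).prod (signMeasure n))
    (F := fun h p => (∑ i, boolSign (p.2 i) * l h (p.1 i)) / n)
    (fun h => by
      have := hl h
      have := measurable_boolSign
      fun_prop)
    (fun h p => abs_sum_div_le zero_le_one fun i => by
      rw [abs_mul, abs_boolSign, one_mul]; exact hb _ _)
  have hnot := measurePreserving_pi (fun _ : Fin n => (PMF.uniformOfFintype Bool).toMeasure)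
    (fun _ : Fin n => (PMF.uniformOfFintype Bool).toMeasure) fun _ => measurePreserving_not_uniform
  have hK : ∫ σ, K (fun i => !σ i) ∂(signMeasure n) = ∫ σ, K σ ∂(signMeasure n) :=
    integral_comp_of_measurePreserving hnot (measurable_of_countable K)
  rw [integral_prod_symm _ hint]
  calc D = ∫ _, D ∂(signMeasure n) := by simp
    _ ≤ ∫ σ, (K σ + K fun i => !σ i) ∂(signMeasure n) :=
      integral_mono Integrable.of_finite Integrable.of_finite hD
    _ = 2 * ∫ σ, K σ ∂(signMeasure n) := by
      rw [integral_add Integrable.of_finite Integrable.of_finite, hK, two_mul]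

end Symmetrization

section CredalBound

variable {n : ℕ}

/-- The zero-one loss of `h`. -/
noncomputable def zeroOneLoss (h : X → Y) (z : X × Y) : ℝ := if z.2 ≠ h z.1 then 1 else 0

omit [MeasurableSpace X] [MeasurableSpace Y] in
lemma zeroOneLoss_eq_indicator (h : X → Y) :
    zeroOneLoss h = (errSet h).indicator fun _ => (1 : ℝ) := by
  ext z
  simp [zeroOneLoss, errSet, Set.indicator_apply]

omit [MeasurableSpace X] [MeasurableSpace Y] in
lemma abs_zeroOneLoss_le (h : X → Y) (z : X × Y) : |zeroOneLoss h z| ≤ 1 := by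
  unfold zeroOneLoss
  split_ifs <;> simp

omit [MeasurableSpace X] [MeasurableSpace Y] in
lemma abs_zeroOneLoss_sub_le (h : X → Y) (z z' : X × Y) :
    |zeroOneLoss h z - zeroOneLoss h z'| ≤ 1 := by
  unfold zeroOneLoss
  split_ifs <;> simp

lemma measurable_zeroOneLoss {h : X → Y} (hh : MeasurableSet (errSet h)) :
    Measurable (zeroOneLoss h) := by
  rw [zeroOneLoss_eq_indicator]
  exact measurable_const.indicator hh

lemma integral_zeroOneLoss (P : Measure (X × Y)) {h : X → Y} (hh : MeasurableSet (errSet h)) :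
    ∫ z, zeroOneLoss h z ∂P = risk P h := by
  rw [zeroOneLoss_eq_indicator, integral_indicator_const _ hh, risk]
  simp [Measure.real]

omit [MeasurableSpace X] [MeasurableSpace Y] in
lemma empRisk_eq_sum (s : Fin n → X × Y) (h : X → Y) :
    empRisk s h = (∑ i, zeroOneLoss h (s i)) / n := by
  simp only [empRisk, zeroOneLoss, Finset.sum_boole]

lemma rademacher_eq (P : Measure (X × Y)) (H : Finset (X → Y)) :
    rademacher n P H = ∫ p : (Fin n → X × Y) × (Fin n → Bool),
      (⨆ h : H, (∑ i, boolSign (p.2 i) * zeroOneLoss (h : X → Y) (p.1 i)) / n)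
      ∂((Measure.pi fun _ => P).prod (signMeasure n)) := rfl

lemma rademacher_le_one (P : Measure (X × Y)) [IsProbabilityMeasure P] {H : Finset (X → Y)}
    (hH : H.Nonempty) : rademacher n P H ≤ 1 := by
  have : Nonempty H := hH.to_subtype
  set F : H → (Fin n → X × Y) × (Fin n → Bool) → ℝ := fun h p =>
    (∑ i, boolSign (p.2 i) * zeroOneLoss (h : X → Y) (p.1 i)) / n
  have hF : ∀ h p, |F h p| ≤ 1 := fun h p => abs_sum_div_le zero_le_one fun i => by
    rw [abs_mul, abs_boolSign, one_mul]
    exact abs_zeroOneLoss_le _ _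
  have hle : ‖∫ p, (⨆ h, F h p) ∂((Measure.pi fun _ : Fin n => P).prod (signMeasure n))‖
      ≤ 1 * ((Measure.pi fun _ : Fin n => P).prod (signMeasure n)).real Set.univ :=
    norm_integral_le_of_norm_le_const (ae_of_all _ (abs_ciSup_le_of_forall_abs_le hF))
  rw [probReal_univ, mul_one] at hle
  rw [rademacher_eq]
  exact (le_abs_self _).trans hle

lemma isProbabilityMeasure_of_memCredal {Z : Type*} [MeasurableSpace Z] {m : ℕ}
    {Pm : Fin m → Measure Z} (hPm : ∀ j, IsProbabilityMeasure (Pm j)) {Q : Measure Z}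
    (hQ : memCredal Pm Q) : IsProbabilityMeasure Q := by
  obtain ⟨w, hw, rfl⟩ := hQ
  refine ⟨?_⟩
  simp only [Measure.coe_finsetSum, Finset.sum_apply, Measure.smul_apply, measure_univ,
    smul_eq_mul, mul_one]
  exact_mod_cast hw

lemma rademacher_le_iSup_memCredal {m : ℕ} {Pm : Fin m → Measure (X × Y)}
    (hPm : ∀ j, IsProbabilityMeasure (Pm j)) {H : Finset (X → Y)} (hH : H.Nonempty)
    {P : Measure (X × Y)} (hP : memCredal Pm P) :
    rademacher n P H ≤ ⨆ Q : {Q : Measure (X × Y) // memCredal Pm Q}, rademacher n Q.1 H := by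
  refine le_ciSup (f := fun Q : {Q : Measure (X × Y) // memCredal Pm Q} => rademacher n Q.1 H)
    ⟨1, ?_⟩ ⟨P, hP⟩
  rintro _ ⟨Q, rfl⟩
  have := isProbabilityMeasure_of_memCredal hPm Q.2
  exact rademacher_le_one Q.1 hH

/-- The largest excess of the generalization gap over the class, relative to `h₀`. -/
noncomputable def excessGap (P : Measure (X × Y)) (H : Finset (X → Y)) (h₀ : X → Y)
    (s : Fin n → X × Y) : ℝ :=
  (⨆ h : H, (risk P (h : X → Y) - (∑ i, zeroOneLoss (h : X → Y) (s i)) / n))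
    - (risk P h₀ - (∑ i, zeroOneLoss h₀ (s i)) / n)

variable {P : Measure (X × Y)} [IsProbabilityMeasure P] {H : Finset (X → Y)} {h₀ : X → Y}

omit [IsProbabilityMeasure P] in
lemma risk_sub_le_excessGap {h : X → Y} (hh : h ∈ H) {s : Fin n → X × Y}
    (he : empRisk s h ≤ empRisk s h₀) : risk P h - risk P h₀ ≤ excessGap P H h₀ s := by
  have h1 := le_ciSup (f := fun h : H => risk P (h : X → Y)
    - (∑ i, zeroOneLoss (h : X → Y) (s i)) / (n : ℝ)) (Set.finite_range _).bddAbove ⟨h, hh⟩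
  rw [empRisk_eq_sum, empRisk_eq_sum] at he
  simp only [excessGap] at h1 ⊢
  linarith

omit [IsProbabilityMeasure P] in
lemma excessGap_nonneg (hh₀ : h₀ ∈ H) (s : Fin n → X × Y) : 0 ≤ excessGap P H h₀ s := by
  simpa using risk_sub_le_excessGap (P := P) hh₀ (le_refl (empRisk s h₀))

omit [IsProbabilityMeasure P] in
lemma measurable_gap {h : X → Y} (hh : MeasurableSet (errSet h)) :
    Measurable fun s : Fin n → X × Y => risk P h - (∑ i, zeroOneLoss h (s i)) / n := by
  have := measurable_zeroOneLoss hh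
  fun_prop

lemma abs_gap_le (h : X → Y) (s : Fin n → X × Y) :
    |risk P h - (∑ i, zeroOneLoss h (s i)) / n| ≤ 2 := by
  refine (abs_sub _ _).trans ?_
  have h1 : |risk P h| ≤ 1 := by
    rw [risk, abs_of_nonneg ENNReal.toReal_nonneg]
    exact measureReal_le_one
  linarith [abs_sum_div_le zero_le_one fun i => abs_zeroOneLoss_le h (s i)]

lemma integral_excessGap_le (hn : 1 ≤ n) (hmeas : ∀ h ∈ H, MeasurableSet (errSet h))
    (hh₀ : h₀ ∈ H) :
    ∫ s, excessGap P H h₀ s ∂(Measure.pi fun _ : Fin n => P) ≤ 2 * rademacher n P H := by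
  have : Nonempty H := ⟨⟨h₀, hh₀⟩⟩
  have hn0 : (n : ℝ) ≠ 0 := by positivity
  have hsym := integral_ciSup_sub_le_two_mul P (l := fun h : H => zeroOneLoss (h : X → Y))
    (fun h => measurable_zeroOneLoss (hmeas h h.2)) (fun h => abs_zeroOneLoss_le _) hn
  simp only [integral_zeroOneLoss P (hmeas _ (Subtype.prop _))] at hsym
  rw [rademacher_eq]
  refine le_of_eq_of_le ?_ hsym
  have hle : ∀ i : Fin n, Integrable (fun s : Fin n → X × Y => zeroOneLoss h₀ (s i))
      (Measure.pi fun _ => P) := fun i => integrable_of_measurable_of_abs_le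
    ((measurable_zeroOneLoss (hmeas _ hh₀)).comp (measurable_pi_apply i))
      fun s => abs_zeroOneLoss_le _ _
  have he : ∀ i : Fin n, ∫ s, zeroOneLoss h₀ (s i) ∂(Measure.pi fun _ : Fin n => P) = risk P h₀ :=
    fun i => by
      rw [integral_comp_eval (μ := fun _ : Fin n => P) (i := i)
        (measurable_zeroOneLoss (hmeas _ hh₀)).aestronglyMeasurable,
        integral_zeroOneLoss P (hmeas _ hh₀)]
  have h0 : ∫ s, (risk P h₀ - (∑ i, zeroOneLoss h₀ (s i)) / n)
      ∂(Measure.pi fun _ : Fin n => P) = 0 := by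
    rw [integral_sub (integrable_const _) ((integrable_finsetSum _ fun i _ => hle i).div_const _),
      integral_div, integral_finsetSum _ fun i _ => hle i]
    simp only [he]
    simp
    field_simp
    simp
  simp only [excessGap]
  rw [integral_sub (integrable_ciSup (fun h : H => measurable_gap (hmeas h h.2))
      fun h s => abs_gap_le _ s)
    (integrable_of_measurable_of_abs_le (measurable_gap (hmeas _ hh₀)) (abs_gap_le h₀)), h0,
    sub_zero]

omit [IsProbabilityMeasure P] in
lemma excessGap_update_sub_le (hh₀ : h₀ ∈ H) (s : Fin n → X × Y) (i : Fin n) (z : X × Y) :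
    excessGap P H h₀ (Function.update s i z) - excessGap P H h₀ s ≤ 2 / n := by
  have : Nonempty H := ⟨⟨h₀, hh₀⟩⟩
  have hupd : ∀ h : X → Y, (∑ j, zeroOneLoss h (Function.update s i z j)) / (n : ℝ)
      = (∑ j, zeroOneLoss h (s j)) / n + (zeroOneLoss h z - zeroOneLoss h (s i)) / n := fun h => by
    rw [← add_div, ← sub_eq_iff_eq_add'.1]
    rw [← Finset.sum_sub_distrib, Finset.sum_eq_single i]
    · simp
    · intro j _ hj
      simp [hj]
    · simp
  have hbd : ∀ h : X → Y, |(zeroOneLoss h z - zeroOneLoss h (s i)) / n| ≤ 1 / n := fun h => by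
    rw [abs_div, Nat.abs_cast]
    gcongr
    exact abs_zeroOneLoss_sub_le _ _ _
  have hsup : (⨆ h : H, (risk P (h : X → Y)
        - (∑ j, zeroOneLoss (h : X → Y) (Function.update s i z j)) / (n : ℝ)))
      ≤ (⨆ h : H, (risk P (h : X → Y) - (∑ j, zeroOneLoss (h : X → Y) (s j)) / n)) + 1 / n := by
    refine ciSup_le fun h => ?_
    have h1 := le_ciSup (f := fun h : H => risk P (h : X → Y)
      - (∑ j, zeroOneLoss (h : X → Y) (s j)) / (n : ℝ)) (Set.finite_range _).bddAbove h
    rw [hupd]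
    linarith [(abs_le.1 (hbd h)).1]
  have h2 := (abs_le.1 (hbd h₀)).2
  have h3 : (2 : ℝ) / n = 1 / n + 1 / n := by ring
  simp only [excessGap]
  rw [hupd h₀]
  linarith

end CredalBound

/-- Credal Rademacher bound (Theorem 3 of the paper). -/
theorem credal_rademacher_bound {m n : ℕ} (hm : 0 < m) (hn : 1 ≤ n)
    (Pm : Fin m → Measure (X × Y)) (hPm : ∀ j, IsProbabilityMeasure (Pm j))
    (H : Finset (X → Y)) (hH : H.Nonempty)
    (hmeas : ∀ h ∈ H, MeasurableSet (errSet h))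
    (erm : (Fin n → X × Y) → (X → Y)) (hermM : MeasurableERM erm) (herm : IsERM H erm)
    (hstar : Measure (X × Y) → (X → Y))
    (hstarH : ∀ P : Measure (X × Y), hstar P ∈ H ∧ ∀ h ∈ H, risk P (hstar P) ≤ risk P h)
    (δ : ℝ) (hδ : δ ∈ Set.Ioo (0 : ℝ) 1)
    (P : Measure (X × Y)) [IsProbabilityMeasure P] (hP : memCredal Pm P) :
    (Measure.pi fun _ : Fin n => P)
        {s | risk P (erm s) - risk P (hstar P)
          ≤ 4 * (⨆ Q : {Q : Measure (X × Y) // memCredal Pm Q}, rademacher n Q.1 H)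
            + Real.sqrt (2 * Real.log (2 / δ) / n)}
      ≥ ENNReal.ofReal (1 - δ) := by
  have hH₀ := (hstarH P).1
  have : Nonempty H := ⟨⟨_, hH₀⟩⟩
  have hn0 : (0 : ℝ) < n := by positivity
  set μ := Measure.pi fun _ : Fin n => P
  set G : (Fin n → X × Y) → ℝ := excessGap P H (hstar P) with hG
  set ε := Real.sqrt (2 * Real.log (2 / δ) / n) with hε
  have hlog : 0 ≤ Real.log (2 / δ) :=
    Real.log_nonneg (by rw [le_div_iff₀ hδ.1]; linarith [hδ.2])
  have hGm : Measurable G :=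
    (Measurable.iSup fun h : H => measurable_gap (hmeas h h.2)).sub (measurable_gap (hmeas _ hH₀))
  have hGb : ∀ s, |G s| ≤ 2 + 2 := fun s =>
    (abs_sub _ _).trans (add_le_add
      (abs_ciSup_le_of_forall_abs_le (F := fun (h : H) (s : Fin n → X × Y) =>
        risk P (h : X → Y) - (∑ i, zeroOneLoss (h : X → Y) (s i)) / (n : ℝ))
        (fun h s => abs_gap_le _ s) s) (abs_gap_le _ s))
  have hmc := measureReal_ge_le_of_bounded_differences P (c := 2 / n) (by positivity) hGm hGb
    (excessGap_update_sub_le hH₀) (Real.sqrt_nonneg (2 * Real.log (2 / δ) / n))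
  have hexp : Real.exp (-ε ^ 2 / (2 * (n * ((2 / n : ℝ) / 2) ^ 2))) ≤ δ := by
    have : -ε ^ 2 / (2 * (n * ((2 / n : ℝ) / 2) ^ 2)) = -Real.log (2 / δ) := by
      rw [hε, Real.sq_sqrt (by positivity)]
      field_simp
    rw [this, Real.exp_neg, Real.exp_log (by have := hδ.1; positivity), inv_div]
    linarith [hδ.1]
  have hmean := integral_excessGap_le (P := P) hn hmeas hH₀
  have hmean0 : 0 ≤ ∫ s, G s ∂μ := integral_nonneg fun s => excessGap_nonneg hH₀ s
  have hsup := rademacher_le_iSup_memCredal (n := n) hPm hH hP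
  set B := {s | ε ≤ G s - ∫ s', G s' ∂μ}
  have hB : MeasurableSet B := measurableSet_le measurable_const (hGm.sub measurable_const)
  have hsub : Bᶜ ⊆ {s | risk P (erm s) - risk P (hstar P)
      ≤ 4 * (⨆ Q : {Q : Measure (X × Y) // memCredal Pm Q}, rademacher n Q.1 H) + ε} := by
    intro s hs
    have h1 : G s - ∫ s', G s' ∂μ < ε := not_le.1 hs
    have h2 : risk P (erm s) - risk P (hstar P) ≤ G s :=
      risk_sub_le_excessGap (herm s).1 ((herm s).2 _ hH₀)
    simp only [Set.mem_ofPred_eq]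
    linarith
  refine le_trans ?_ (measure_mono hsub)
  rw [← ofReal_measureReal, probReal_compl_eq_one_sub hB]
  exact ENNReal.ofReal_le_ofReal (by linarith)
end

section
/- Let P be a probability measure on Z and let H be a finite nonempty hypothesis class with measurable error sets. Then for every ε > 0 and n ≥ 1, P^{⊗n}({s ∈ Z^n : ∃h ∈ H, |L̂_s(h) − L_P(h)| > ε/2}) ≤ 2|H| · exp(−n ε²/2). -/
open MeasureTheory Finset
open scoped ENNReal NNReal Classical

variable {X Y : Type*}

variable [MeasurableSpace X] [MeasurableSpace Y]

/-- Chernoff bound for the sample mean of a sub-Gaussian function under a product measure. -/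
theorem measure_pi_sum_ge_le_of_hasSubgaussianMGF {Z : Type*} [MeasurableSpace Z] {n : ℕ}
    {P : Measure Z} [IsProbabilityMeasure P] {g : Z → ℝ} {c : ℝ≥0}
    (hg : ProbabilityTheory.HasSubgaussianMGF g c P) {t : ℝ} (ht : 0 ≤ t) :
    (Measure.pi fun _ : Fin n => P) {s | n * t ≤ ∑ i, g (s i)}
      ≤ ENNReal.ofReal (Real.exp (-(n * t) ^ 2 / (2 * (n * c)))) := by
  have hindep := ProbabilityTheory.iIndepFun_pi (μ := fun _ : Fin n => P)
    (X := fun _ => g) fun _ => hg.aemeasurable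
  have hsub : ∀ i ∈ (Finset.univ : Finset (Fin n)), ProbabilityTheory.HasSubgaussianMGF
      (fun s : Fin n → Z => g (s i)) c (Measure.pi fun _ : Fin n => P) := by
    intro i _
    have hmp := measurePreserving_eval (fun _ : Fin n => P) i
    refine ProbabilityTheory.HasSubgaussianMGF.of_map (Y := Function.eval i) (X := g)
      hmp.measurable.aemeasurable ?_
    rwa [hmp.map_eq]
  have h := ProbabilityTheory.HasSubgaussianMGF.measure_sum_ge_le_of_iIndepFun hindep
    (c := fun _ => c) hsub (ε := n * t) (by positivity)
  rw [← ofReal_measureReal]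
  refine ENNReal.ofReal_le_ofReal (h.trans_eq ?_)
  simp

/-- The centred zero-one loss is sub-Gaussian with variance proxy `1 / 4`. -/
theorem hasSubgaussianMGF_indicator_sub_measureReal {Z : Type*} [MeasurableSpace Z]
    {P : Measure Z} [IsProbabilityMeasure P] {A : Set Z} (hA : MeasurableSet A) :
    ProbabilityTheory.HasSubgaussianMGF (fun z => A.indicator 1 z - P.real A) (1 / 4) P := by
  have h := ProbabilityTheory.hasSubgaussianMGF_of_mem_Icc (μ := P) (a := 0) (b := 1)
    (X := A.indicator (1 : Z → ℝ)) (measurable_one.indicator hA).aemeasurable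
    (ae_of_all _ fun z => by by_cases hz : z ∈ A <;> simp [hz])
  rw [integral_indicator_one hA] at h
  convert h using 1
  norm_num

theorem sum_indicator_errSet_sub_risk {n : ℕ} (hn : 1 ≤ n) (P : Measure (X × Y))
    (s : Fin n → X × Y) (h : X → Y) :
    ∑ i, ((errSet h).indicator 1 (s i) - P.real (errSet h)) = n * (empRisk s h - risk P h) := by
  have hn' : (n : ℝ) ≠ 0 := by positivity
  rw [Finset.sum_sub_distrib, mul_sub, empRisk, mul_div_cancel₀ _ hn', Finset.card_filter]
  simp [Set.indicator_apply, errSet, risk, Measure.real]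

/-- Hoeffding's inequality for the empirical risk of a single hypothesis. -/
theorem measure_abs_empRisk_sub_risk_gt_le {n : ℕ} (hn : 1 ≤ n)
    (P : Measure (X × Y)) [IsProbabilityMeasure P] {h : X → Y}
    (hmeas : MeasurableSet (errSet h)) {ε : ℝ} (hε : 0 < ε) :
    (Measure.pi fun _ : Fin n => P) {s | |empRisk s h - risk P h| > ε / 2}
      ≤ 2 * ENNReal.ofReal (Real.exp (-(n : ℝ) * ε ^ 2 / 2)) := by
  have hn' : (0 : ℝ) < n := by positivity
  have hg := hasSubgaussianMGF_indicator_sub_measureReal (P := P) hmeas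
  have hexp : -((n : ℝ) * (ε / 2)) ^ 2 / (2 * (n * ((1 / 4 : ℝ≥0) : ℝ)))
      = -(n : ℝ) * ε ^ 2 / 2 := by
    push_cast
    field_simp
    ring
  have hupper := measure_pi_sum_ge_le_of_hasSubgaussianMGF (n := n) hg (half_pos hε).le
  have hlower := measure_pi_sum_ge_le_of_hasSubgaussianMGF (n := n) hg.neg (half_pos hε).le
  rw [hexp] at hupper hlower
  rw [two_mul]
  refine le_trans (measure_mono ?_) ((measure_union_le _ _).trans (add_le_add hupper hlower))
  intro s hs
  have hs' : ε / 2 < |empRisk s h - risk P h| := hs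
  simp only [Set.mem_union, Set.mem_ofPred_eq, Pi.neg_apply, Finset.sum_neg_distrib,
    sum_indicator_errSet_sub_risk hn, ← mul_neg]
  exact (lt_abs.mp hs').imp (fun hlt => by gcongr) (fun hlt => by gcongr)

/-- Uniform convergence of empirical risks over a finite hypothesis class. -/
theorem uniform_convergence_finite {n : ℕ} (hn : 1 ≤ n)
    (P : Measure (X × Y)) [IsProbabilityMeasure P]
    (H : Finset (X → Y)) (hH : H.Nonempty)
    (hmeas : ∀ h ∈ H, MeasurableSet (errSet h))
    (ε : ℝ) (hε : 0 < ε) :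
    (Measure.pi fun _ : Fin n => P) {s | ∃ h ∈ H, |empRisk s h - risk P h| > ε / 2}
      ≤ 2 * (H.card : ℝ≥0∞) * ENNReal.ofReal (Real.exp (-(n : ℝ) * ε ^ 2 / 2)) := by
  have hset : {s : Fin n → X × Y | ∃ h ∈ H, |empRisk s h - risk P h| > ε / 2}
      = ⋃ h ∈ H, {s | |empRisk s h - risk P h| > ε / 2} := by
    ext s
    simp
  rw [hset]
  calc _ ≤ ∑ h ∈ H, (Measure.pi fun _ : Fin n => P) {s | |empRisk s h - risk P h| > ε / 2} :=
        measure_biUnion_finset_le _ _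
    _ ≤ ∑ _h ∈ H, 2 * ENNReal.ofReal (Real.exp (-(n : ℝ) * ε ^ 2 / 2)) :=
        Finset.sum_le_sum fun h hh => measure_abs_empRisk_sub_risk_gt_le hn P (hmeas h hh) hε
    _ = 2 * (H.card : ℝ≥0∞) * ENNReal.ofReal (Real.exp (-(n : ℝ) * ε ^ 2 / 2)) := by
        rw [Finset.sum_const, nsmul_eq_mul]
        ring
end
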